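/- Fix a positive integer d, a real number p ≥ 1 and a real number N > 0. Let μ_N be a random finite positive Borel measure on the cube Q_N = [0, N^{1/d}]^d such that: (1) there exists a monotone (non-decreasing or non-increasing) function g : [1,∞) → (0,∞) such that for every axis-parallel cube B ⊂ Q_N with |B| ≥ 1 one has E[|μ_N(B) − E[μ_N(B)]|^p] ≤ |B|^{p(d−1)/d} g(|B|)^p; (2) there exist constants a ∈ (0,1] and A ∈ [1,∞) such that a|B| ≤ E[μ_N(B)] ≤ A|B| for every axis-parallel cube B ⊂ Q_N. Let M_N = μ_N(Q_N) and μ̄_N = (M_N / E[M_N]) · E[μ_N]. Then there exists a constant C_{p,d}, depending only on p and d, such that E[W_p^p(μ_N, μ̄_N)] ≤ C_{p,d} a^{1−2p} A^p N (1 + ∫_1^{max(1,N)} g(y) y^{−1} dy)^p. -/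

import Mathlib

open MeasureTheory ENNReal

noncomputable section

/-- The `p`-th power of the `p`-Wasserstein distance between two positive Borel
measures on `ℝ^d`: infimum over couplings of the integral of `dist^p`. -/
def WpPow {d : ℕ} (p : ℝ)
    (μ ν : Measure (EuclideanSpace ℝ (Fin d))) : ℝ≥0∞ :=
  ⨅ π ∈ {π : Measure (EuclideanSpace ℝ (Fin d) × EuclideanSpace ℝ (Fin d)) |
      π.map Prod.fst = μ ∧ π.map Prod.snd = ν},
    ∫⁻ z, edist z.1 z.2 ^ p ∂π

/-- Axis-parallel cube in `ℝ^d`. -/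
def IsAxisCube {d : ℕ} (B : Set (EuclideanSpace ℝ (Fin d))) : Prop :=
  ∃ (c : EuclideanSpace ℝ (Fin d)) (s : ℝ), 0 ≤ s ∧
    B = {x | ∀ i, c i ≤ x i ∧ x i ≤ c i + s}

/-- The cube `Q_N = [0, N^{1/d}]^d`. -/
def QdN (d : ℕ) (N : ℝ) : Set (EuclideanSpace ℝ (Fin d)) :=
  {x | ∀ i, 0 ≤ x i ∧ x i ≤ N ^ ((1 : ℝ) / d)}

/-- There is a coupling of `μ` and `ν` whose `p`-cost is at most `T`. -/
def TransportLE {X : Type*} [PseudoEMetricSpace X] [MeasurableSpace X] (p : ℝ)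
    (μ ν : Measure X) (T : ℝ≥0∞) : Prop :=
  ∃ π : Measure (X × X), π.map Prod.fst = μ ∧ π.map Prod.snd = ν ∧
    ∫⁻ z, edist z.1 z.2 ^ p ∂π ≤ T

namespace TransportLE

variable {X : Type*} [PseudoEMetricSpace X] [MeasurableSpace X] {p : ℝ}

theorem mono {μ ν : Measure X} {T T' : ℝ≥0∞} (h : TransportLE p μ ν T) (hT : T ≤ T') :
    TransportLE p μ ν T' := by
  obtain ⟨π, h1, h2, h3⟩ := h
  exact ⟨π, h1, h2, h3.trans hT⟩

theorem symm {μ ν : Measure X} {T : ℝ≥0∞} (h : TransportLE p μ ν T) : TransportLE p ν μ T := by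
  obtain ⟨π, h1, h2, h3⟩ := h
  refine ⟨π.map Prod.swap, ?_, ?_, ?_⟩
  · rw [Measure.map_map measurable_fst measurable_swap, ← h2]
    rfl
  · rw [Measure.map_map measurable_snd measurable_swap, ← h1]
    rfl
  · refine le_of_eq_of_le ?_ h3
    rw [show π.map Prod.swap = π.map MeasurableEquiv.prodComm from rfl, lintegral_map_equiv]
    exact lintegral_congr fun z => by rw [edist_comm]; rfl

theorem add {μ ν μ' ν' : Measure X} {T T' : ℝ≥0∞} (h : TransportLE p μ ν T)
    (h' : TransportLE p μ' ν' T') : TransportLE p (μ + μ') (ν + ν') (T + T') := by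
  obtain ⟨π, h1, h2, h3⟩ := h
  obtain ⟨π', h1', h2', h3'⟩ := h'
  refine ⟨π + π', ?_, ?_, ?_⟩
  · rw [Measure.map_add _ _ measurable_fst, h1, h1']
  · rw [Measure.map_add _ _ measurable_snd, h2, h2']
  · rw [lintegral_add_measure]
    exact add_le_add h3 h3'

theorem smul {μ ν : Measure X} {T : ℝ≥0∞} (h : TransportLE p μ ν T) (c : ℝ≥0∞) :
    TransportLE p (c • μ) (c • ν) (c * T) := by
  obtain ⟨π, h1, h2, h3⟩ := h
  refine ⟨c • π, ?_, ?_, ?_⟩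
  · rw [Measure.map_smul, h1]
  · rw [Measure.map_smul, h2]
  · rw [lintegral_smul_measure, smul_eq_mul]
    gcongr

theorem zero : TransportLE p (0 : Measure X) 0 0 :=
  ⟨0, by simp, by simp, by simp⟩

theorem sum {ι : Type*} (s : Finset ι) {μ ν : ι → Measure X} {T : ι → ℝ≥0∞}
    (h : ∀ i ∈ s, TransportLE p (μ i) (ν i) (T i)) :
    TransportLE p (∑ i ∈ s, μ i) (∑ i ∈ s, ν i) (∑ i ∈ s, T i) := by
  classical
  induction s using Finset.induction_on with
  | empty => simpa using zero
  | insert i s hi ih =>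
    rw [Finset.sum_insert hi, Finset.sum_insert hi, Finset.sum_insert hi]
    exact (h i (Finset.mem_insert_self i s)).add
      (ih fun j hj => h j (Finset.mem_insert_of_mem hj))

/-- Two finite measures of the same mass carried by a set of diameter at most `R`. -/
theorem of_edist_le (hp : 0 < p) {μ ν : Measure X} [IsFiniteMeasure μ] [IsFiniteMeasure ν]
    (hmass : μ Set.univ = ν Set.univ) {E : Set X} (hμ : μ Eᶜ = 0)
    (hν : ν Eᶜ = 0) {R : ℝ≥0∞} (hR : ∀ x ∈ E, ∀ y ∈ E, edist x y ≤ R) :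
    TransportLE p μ ν (R ^ p * μ Set.univ) := by
  by_cases h0 : μ Set.univ = 0
  · have h1 : μ = 0 := Measure.measure_univ_eq_zero.1 h0
    have h2 : ν = 0 := Measure.measure_univ_eq_zero.1 (hmass ▸ h0)
    subst h1 h2
    simpa using zero
  have ht : μ Set.univ ≠ ⊤ := measure_ne_top _ _
  refine ⟨(μ Set.univ)⁻¹ • μ.prod ν, ?_, ?_, ?_⟩
  · rw [Measure.map_smul, Measure.map_fst_prod, ← hmass, smul_smul,
      ENNReal.inv_mul_cancel h0 ht, one_smul]
  · rw [Measure.map_smul, Measure.map_snd_prod, smul_smul,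
      ENNReal.inv_mul_cancel h0 ht, one_smul]
  · have hae : ∀ᵐ z ∂(μ.prod ν), edist z.1 z.2 ^ p ≤ R ^ p := by
      have h1 : ∀ᵐ z ∂(μ.prod ν), z.1 ∈ E :=
        Measure.quasiMeasurePreserving_fst.ae (p := fun x => x ∈ E) hμ
      have h2 : ∀ᵐ z ∂(μ.prod ν), z.2 ∈ E :=
        Measure.quasiMeasurePreserving_snd.ae (p := fun x => x ∈ E) hν
      filter_upwards [h1, h2] with z hz1 hz2
      exact ENNReal.rpow_le_rpow (hR _ hz1 _ hz2) hp.le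
    rw [lintegral_smul_measure, smul_eq_mul]
    calc (μ Set.univ)⁻¹ * ∫⁻ z, edist z.1 z.2 ^ p ∂(μ.prod ν)
        ≤ (μ Set.univ)⁻¹ * ∫⁻ _, R ^ p ∂(μ.prod ν) := by
          exact mul_le_mul' le_rfl (lintegral_mono_ae hae)
      _ = R ^ p * μ Set.univ := by
          rw [lintegral_const, ← Set.univ_prod_univ, Measure.prod_prod, ← hmass,
            mul_comm, mul_assoc, mul_assoc, ENNReal.mul_inv_cancel h0 ht, mul_one]

variable [OpensMeasurableSpace X] [SecondCountableTopology X]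

theorem refl (hp : 0 < p) (μ : Measure X) : TransportLE p μ μ 0 := by
  have hd : Measurable fun x : X => (x, x) := measurable_id.prodMk measurable_id
  refine ⟨μ.map fun x => (x, x), ?_, ?_, ?_⟩
  · rw [Measure.map_map measurable_fst hd]
    exact Measure.map_id
  · rw [Measure.map_map measurable_snd hd]
    exact Measure.map_id
  · rw [lintegral_map (measurable_edist.pow_const p) hd]
    simp [hp]

theorem trans [StandardBorelSpace X] (hp : 1 ≤ p) {μ ν ρ : Measure X} [IsFiniteMeasure μ]
    [IsFiniteMeasure ν] {R S : ℝ≥0∞}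
    (h : TransportLE p μ ν (R ^ p)) (h' : TransportLE p ν ρ (S ^ p)) :
    TransportLE p μ ρ ((R + S) ^ p) := by
  have hp0 : 0 < p := zero_lt_one.trans_le hp
  obtain ⟨π, h1, h2, h3⟩ := h
  obtain ⟨π', h1', h2', h3'⟩ := h'
  rcases isEmpty_or_nonempty X with hX | hX
  · have e1 : μ = 0 := Measure.eq_zero_of_isEmpty _
    have e2 : ρ = 0 := Measure.eq_zero_of_isEmpty _
    rw [e1, e2]
    exact zero.mono zero_le
  have : IsFiniteMeasure π := ⟨by
    have := congrArg (fun m => m Set.univ) h1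
    simp only [Measure.map_apply measurable_fst MeasurableSet.univ, Set.preimage_univ] at this
    rw [this]; exact measure_lt_top _ _⟩
  have : IsFiniteMeasure π' := ⟨by
    have := congrArg (fun m => m Set.univ) h1'
    simp only [Measure.map_apply measurable_fst MeasurableSet.univ, Set.preimage_univ] at this
    rw [this]; exact measure_lt_top _ _⟩
  let κ := π'.condKernel
  let τ := π.compProd (κ.comap Prod.snd measurable_snd)
  have hτ1 : τ.map Prod.fst = π := Measure.fst_compProd _ _
  have hτ2 : τ.map (fun z => (z.1.2, z.2)) = π' := by
    have hdis : ν.compProd κ = π' := by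
      have := π'.disintegrate π'.condKernel
      rwa [show π'.fst = ν from h1'] at this
    rw [← hdis, ← h2]
    ext s hs
    have hm : Measurable fun z : (X × X) × X => (z.1.2, z.2) := by fun_prop
    rw [Measure.map_apply hm hs, Measure.compProd_apply (hm hs), Measure.compProd_apply hs,
      lintegral_map (ProbabilityTheory.Kernel.measurable_kernel_prodMk_left hs) measurable_snd]
    rfl
  have hm1 : Measurable fun z : (X × X) × X => edist z.1.1 z.1.2 :=
    measurable_edist.comp measurable_fst
  have hm' : Measurable fun z : (X × X) × X => (z.1.2, z.2) := by fun_prop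
  have hm2 : Measurable fun z : (X × X) × X => edist z.1.2 z.2 :=
    measurable_edist.comp hm'
  have hm13 : Measurable fun z : (X × X) × X => (z.1.1, z.2) := by fun_prop
  refine ⟨τ.map (fun z => (z.1.1, z.2)), ?_, ?_, ?_⟩
  · rw [Measure.map_map measurable_fst hm13, ← h1, ← hτ1,
      Measure.map_map measurable_fst measurable_fst]
    rfl
  · rw [Measure.map_map measurable_snd hm13, ← h2', ← hτ2,
      Measure.map_map measurable_snd hm']
    rfl
  · rw [lintegral_map (measurable_edist.pow_const p) hm13]
    have i1 : ∫⁻ z, edist z.1.1 z.1.2 ^ p ∂τ ≤ R ^ p := by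
      rwa [← hτ1, lintegral_map (measurable_edist.pow_const p) measurable_fst] at h3
    have i2 : ∫⁻ z, edist z.1.2 z.2 ^ p ∂τ ≤ S ^ p := by
      rwa [← hτ2, lintegral_map (measurable_edist.pow_const p) hm'] at h3'
    have hroot : ∀ {a b : ℝ≥0∞}, a ≤ b ^ p → a ^ (1 / p) ≤ b := fun {a b} hab => by
      rw [one_div]
      exact (ENNReal.rpow_inv_le_iff hp0).2 hab
    have key := ENNReal.lintegral_Lp_add_le (μ := τ) hm1.aemeasurable hm2.aemeasurable hp
    have hle : (∫⁻ z, (edist z.1.1 z.2) ^ p ∂τ) ≤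
        ∫⁻ z, ((fun z : (X × X) × X => edist z.1.1 z.1.2) +
          fun z : (X × X) × X => edist z.1.2 z.2) z ^ p ∂τ :=
      lintegral_mono fun z => ENNReal.rpow_le_rpow (edist_triangle _ _ _) hp0.le
    refine hle.trans ?_
    rw [one_div] at key
    rw [← ENNReal.rpow_inv_le_iff hp0]
    refine key.trans ?_
    rw [← one_div]
    exact add_le_add (hroot i1) (hroot i2)

end TransportLE

/-- Minus the partial sums of `v` along `Fin n`. -/
def lineFlux {n : ℕ} [NeZero n] (v : Fin n → ℝ) (t : Fin n) : ℝ :=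
  -∑ k ∈ Finset.range (t.val + 1), v (Fin.ofNat n k)

theorem lineFlux_last {n : ℕ} [NeZero n] {v : Fin n → ℝ} (hv : ∑ t, v t = 0) {t : Fin n}
    (ht : ¬ t.val + 1 < n) : lineFlux v t = 0 := by
  have h1 : t.val + 1 = n := by have := t.isLt; omega
  have h2 : ∑ k ∈ Finset.range n, v (Fin.ofNat n k) = ∑ t, v t := by
    rw [← Fin.sum_univ_eq_sum_range (fun k => v (Fin.ofNat n k))]
    simp
  rw [lineFlux, h1, h2, hv, neg_zero]

theorem lineFlux_sub {n : ℕ} [NeZero n] {v : Fin n → ℝ} (hv : ∑ t, v t = 0) (t : Fin n) :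
    lineFlux v t - lineFlux v (t + 1) = v (t + 1) := by
  by_cases ht : t.val + 1 < n
  · have h1 : (t + 1).val = t.val + 1 := Fin.val_add_one_of_lt' ht
    have h2 : Fin.ofNat n (t.val + 1) = t + 1 := by
      apply Fin.ext
      rw [h1, Fin.val_ofNat, Nat.mod_eq_of_lt ht]
    rw [lineFlux, lineFlux, h1, Finset.sum_range_succ _ (t.val + 1), h2]
    ring
  · have h1 : t + 1 = 0 := by
      apply Fin.ext
      have h2 : t.val + 1 = n := by have := t.isLt; omega
      rw [Fin.val_add, Fin.val_zero, show ((1 : Fin n) : ℕ) = 1 % n from rfl, Nat.add_mod_mod, h2,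
        Nat.mod_self]
    rw [lineFlux_last hv ht, h1, lineFlux]
    simp

theorem abs_lineFlux_le {n : ℕ} [NeZero n] {v : Fin n → ℝ} {B : ℝ} (hB : ∀ t, |v t| ≤ B)
    (t : Fin n) : |lineFlux v t| ≤ n * B := by
  have hB0 : 0 ≤ B := (abs_nonneg _).trans (hB t)
  rw [lineFlux, abs_neg]
  calc |∑ k ∈ Finset.range (t.val + 1), v (Fin.ofNat n k)|
      ≤ ∑ k ∈ Finset.range (t.val + 1), |v (Fin.ofNat n k)| := Finset.abs_sum_le_sum_abs _ _
    _ ≤ ∑ k ∈ Finset.range (t.val + 1), B := Finset.sum_le_sum fun k _ => hB _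
    _ = ((t.val + 1 : ℕ) : ℝ) * B := by rw [Finset.sum_const, Finset.card_range, nsmul_eq_mul]
    _ ≤ n * B := by
      gcongr
      exact t.isLt

/-- The cyclic shift of the `j`-th coordinate of a multi-index. -/
def coordShift {d n : ℕ} [NeZero n] (j : Fin d) : (Fin d → Fin n) ≃ (Fin d → Fin n) where
  toFun q := Function.update q j (q j + 1)
  invFun q := Function.update q j (q j - 1)
  left_inv q := by simp
  right_inv q := by simp

/-- The mixture of the measures `κ q` with weights `w q`. -/
def mixture {ι X : Type*} [Fintype ι] [MeasurableSpace X] (κ : ι → Measure X) (w : ι → ℝ) :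
    Measure X :=
  ∑ q, ENNReal.ofReal (w q) • κ q

section Mixture

variable {ι X : Type*} [Fintype ι] [MeasurableSpace X] (κ : ι → Measure X)

theorem mixture_add {w w' : ι → ℝ} (hw : ∀ q, 0 ≤ w q) (hw' : ∀ q, 0 ≤ w' q) :
    mixture κ (fun q => w q + w' q) = mixture κ w + mixture κ w' := by
  simp only [mixture]
  rw [← Finset.sum_add_distrib]
  refine Finset.sum_congr rfl fun q _ => ?_
  rw [ENNReal.ofReal_add (hw q) (hw' q), add_smul]

theorem mixture_comp_equiv (e : ι ≃ ι) (w : ι → ℝ) :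
    mixture κ (fun q => w (e.symm q)) = mixture (fun q => κ (e q)) w := by
  simp only [mixture]
  rw [← Equiv.sum_comp e]
  simp

instance [∀ q, IsFiniteMeasure (κ q)] (w : ι → ℝ) : IsFiniteMeasure (mixture κ w) := by
  constructor
  simp only [mixture, Measure.coe_finsetSum, Finset.sum_apply, Measure.smul_apply, smul_eq_mul]
  exact ENNReal.sum_lt_top.2 fun q _ =>
    ENNReal.mul_lt_top ENNReal.ofReal_lt_top (measure_lt_top _ _)

end Mixture

section Flow

variable {d n : ℕ} [NeZero n] {X : Type*} [PseudoEMetricSpace X] [MeasurableSpace X]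
  [OpensMeasurableSpace X] [SecondCountableTopology X] {p : ℝ}

theorem transportLE_line (hp : 0 < p) (κ : (Fin d → Fin n) → Measure X) (j : Fin d) {R : ℝ≥0∞}
    (hκ : ∀ q, (q j).val + 1 < n → TransportLE p (κ q) (κ (coordShift j q)) R ∧
      TransportLE p (κ (coordShift j q)) (κ q) R)
    {S : ℝ} {y u : (Fin d → Fin n) → ℝ}
    (hu0 : ∀ q, ∑ t, u (Function.update q j t) = 0) (hu : ∀ q, |u q| ≤ 2 * S)
    (hy : ∀ q, 4 * n * S ≤ y q) :
    TransportLE p (mixture κ y) (mixture κ fun q => y q + u q)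
      (ENNReal.ofReal ((n : ℝ) ^ d * (2 * n * S)) * R) := by
  set e := coordShift (n := n) j with he
  set f : (Fin d → Fin n) → ℝ := fun q => lineFlux (fun t => u (Function.update q j t)) (q j)
    with hf
  have hfe : ∀ q, f q - f (e q) = u (e q) := by
    intro q
    have h1 : f (e q) = lineFlux (fun t => u (Function.update q j t)) (q j + 1) := by
      simp [hf, he, coordShift]
    have h2 := lineFlux_sub (hu0 q) (q j)
    rw [h1]
    exact h2
  have hfe' : ∀ q, f (e.symm q) - f q = u q := by
    intro q
    simpa using hfe (e.symm q)
  have hfb : ∀ q, |f q| ≤ 2 * n * S := fun q =>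
    (abs_lineFlux_le (fun t => hu _) _).trans_eq (by ring)
  have hf0 : ∀ q, ¬ (q j).val + 1 < n → f q = 0 := fun q hq => lineFlux_last (hu0 q) hq
  have hpm : ∀ x : ℝ, max x 0 - max (-x) 0 = x := fun x => by
    rcases le_total x 0 with h | h
    · rw [max_eq_right h, max_eq_left (by linarith)]; ring
    · rw [max_eq_left h, max_eq_right (by linarith)]; ring
  have hpa : ∀ x : ℝ, max x 0 + max (-x) 0 = |x| := fun x => by
    rcases le_total x 0 with h | h
    · rw [max_eq_right h, max_eq_left (by linarith), abs_of_nonpos h]; ring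
    · rw [max_eq_left h, max_eq_right (by linarith), abs_of_nonneg h]; ring
  set r : (Fin d → Fin n) → ℝ := fun q => y q - max (f q) 0 - max (-f (e.symm q)) 0 with hr
  have hr0 : ∀ q, 0 ≤ r q := by
    intro q
    have h1 : max (f q) 0 ≤ 2 * n * S :=
      max_le ((le_abs_self _).trans (hfb q)) ((abs_nonneg _).trans (hfb q))
    have h2 : max (-f (e.symm q)) 0 ≤ 2 * n * S :=
      max_le ((neg_le_abs _).trans (hfb _)) ((abs_nonneg _).trans (hfb q))
    have := hy q
    simp only [hr]
    linarith
  have hplus : ∀ q, 0 ≤ max (f q) 0 := fun q => le_max_right _ _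
  have hminus : ∀ q, 0 ≤ max (-f q) 0 := fun q => le_max_right _ _
  have e1 : mixture κ y = mixture κ r + mixture κ (fun q => max (f q) 0) +
      mixture (fun q => κ (e q)) (fun q => max (-f q) 0) := by
    rw [← mixture_comp_equiv κ e (fun q => max (-f q) 0), ← mixture_add κ hr0 hplus,
      ← mixture_add κ (fun q => add_nonneg (hr0 q) (hplus q)) (fun q => hminus _)]
    congr 1
    funext q
    simp only [hr]
    ring
  have e2 : mixture κ (fun q => y q + u q) = mixture κ r +
      mixture (fun q => κ (e q)) (fun q => max (f q) 0) + mixture κ (fun q => max (-f q) 0) := by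
    rw [← mixture_comp_equiv κ e (fun q => max (f q) 0),
      ← mixture_add κ hr0 (fun q => hplus _),
      ← mixture_add κ (fun q => add_nonneg (hr0 q) (hplus _)) hminus]
    congr 1
    funext q
    have h1 := hfe' q
    have h2 := hpm (f q)
    have h3 := hpm (f (e.symm q))
    simp only [hr]
    linarith
  rw [e1, e2]
  have t1 : TransportLE p (mixture κ (fun q => max (f q) 0))
      (mixture (fun q => κ (e q)) (fun q => max (f q) 0))
      (∑ q, ENNReal.ofReal (max (f q) 0) * R) := by
    refine TransportLE.sum _ fun q _ => ?_
    by_cases hq : (q j).val + 1 < n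
    · exact (hκ q hq).1.smul _
    · simpa [hf0 q hq] using TransportLE.zero
  have t2 : TransportLE p (mixture (fun q => κ (e q)) (fun q => max (-f q) 0))
      (mixture κ (fun q => max (-f q) 0)) (∑ q, ENNReal.ofReal (max (-f q) 0) * R) := by
    refine TransportLE.sum _ fun q _ => ?_
    by_cases hq : (q j).val + 1 < n
    · exact (hκ q hq).2.smul _
    · simpa [hf0 q hq] using TransportLE.zero
  refine (((TransportLE.refl hp _).add t1).add t2).mono ?_
  rw [zero_add, ← Finset.sum_add_distrib]
  calc ∑ q, (ENNReal.ofReal (max (f q) 0) * R + ENNReal.ofReal (max (-f q) 0) * R)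
      ≤ ∑ _q : Fin d → Fin n, ENNReal.ofReal (2 * n * S) * R := by
        refine Finset.sum_le_sum fun q _ => ?_
        rw [← add_mul, ← ENNReal.ofReal_add (hplus q) (hminus q), hpa]
        gcongr
        exact hfb q
    _ = ENNReal.ofReal ((n : ℝ) ^ d * (2 * n * S)) * R := by
        rw [Finset.sum_const, Finset.card_univ, nsmul_eq_mul, ← mul_assoc,
          ENNReal.ofReal_mul (by positivity)]
        congr 2
        simp [ENNReal.ofReal_pow]

theorem transportLE_flow [StandardBorelSpace X] (hp : 1 ≤ p)
    (κ : (Fin d → Fin n) → Measure X) [∀ q, IsFiniteMeasure (κ q)] {R : ℝ≥0∞}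
    (hκ : ∀ j q, (q j).val + 1 < n → TransportLE p (κ q) (κ (coordShift j q)) R ∧
      TransportLE p (κ (coordShift j q)) (κ q) R)
    {S : ℝ} (hS : 0 ≤ S) {x : (Fin d → Fin n) → ℝ} (hx : ∀ q, 5 * n * S ≤ x q)
    (J : Finset (Fin d)) (s : (Fin d → Fin n) → ℝ)
    (hJ : ∀ j ∉ J, ∀ q t, s (Function.update q j t) = s q)
    (hs : ∀ q, |s q| ≤ S) (hs0 : ∑ q, s q = 0) :
    TransportLE p (mixture κ x) (mixture κ fun q => x q + s q)
      ((J.card * (ENNReal.ofReal ((n : ℝ) ^ d * (2 * n * S)) * R) ^ (1 / p)) ^ p) := by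
  have hp0 : 0 < p := zero_lt_one.trans_le hp
  have hn : (1 : ℝ) ≤ n := by exact_mod_cast NeZero.one_le
  induction J using Finset.induction_on generalizing s with
  | empty =>
    have hconst : ∀ q q', s q = s q' := by
      intro q q'
      have : ∀ A : Finset (Fin d), s (A.piecewise q q') = s q' := by
        intro A
        induction A using Finset.induction_on with
        | empty => simp
        | insert j A hj ih =>
          rw [Finset.piecewise_insert, hJ j (Finset.notMem_empty j), ih]
      simpa using this Finset.univ
    have hzero : ∀ q, s q = 0 := by
      intro q
      have h1 : ∑ q', s q' = (Fintype.card (Fin d → Fin n) : ℝ) * s q := by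
        rw [Finset.sum_congr rfl fun q' _ => hconst q' q]
        simp
      rw [hs0] at h1
      have h2 : (Fintype.card (Fin d → Fin n) : ℝ) ≠ 0 := by
        have : 0 < Fintype.card (Fin d → Fin n) := Fintype.card_pos
        positivity
      rcases mul_eq_zero.1 h1.symm with h | h
      · exact absurd h h2
      · exact h
    simpa [hzero, hp0] using TransportLE.refl hp0 (mixture κ x)
  | insert j J hj ih =>
    set m : (Fin d → Fin n) → ℝ := fun q => (∑ t, s (Function.update q j t)) / n with hm
    have hnpos : (0 : ℝ) < n := by linarith
    have hmj : ∀ q t, m (Function.update q j t) = m q := fun q t => by simp [hm]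
    have hmJ : ∀ i ∉ J, ∀ q t, m (Function.update q i t) = m q := by
      intro i hi q t
      by_cases hij : i = j
      · subst hij; exact hmj q t
      · simp only [hm]
        congr 1
        refine Finset.sum_congr rfl fun t' _ => ?_
        rw [Function.update_comm hij,
          hJ i (by simp [hij, hi])]
    have hmS : ∀ q, |m q| ≤ S := by
      intro q
      simp only [hm]
      rw [abs_div, abs_of_pos hnpos, div_le_iff₀ hnpos]
      calc |∑ t, s (Function.update q j t)| ≤ ∑ t, |s (Function.update q j t)| :=
            Finset.abs_sum_le_sum_abs _ _
        _ ≤ ∑ _t : Fin n, S := Finset.sum_le_sum fun t _ => hs _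
        _ = S * n := by simp [mul_comm]
    have hshift : ∀ q, ∑ t, s (Function.update q j t) =
        ∑ t, s (Function.update q j (q j + t)) := fun q =>
      (Equiv.sum_comp (Equiv.addLeft (q j)) fun t => s (Function.update q j t)).symm
    have hm0 : ∑ q, m q = 0 := by
      simp only [hm]
      rw [← Finset.sum_div, Finset.sum_congr rfl fun q _ => hshift q, Finset.sum_comm]
      have : ∀ t : Fin n, ∑ q : Fin d → Fin n, s (Function.update q j (q j + t)) = 0 := by
        intro t
        let e : (Fin d → Fin n) ≃ (Fin d → Fin n) :=
          { toFun := fun q => Function.update q j (q j + t)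
            invFun := fun q => Function.update q j (q j - t)
            left_inv := fun q => by simp
            right_inv := fun q => by simp }
        rw [← hs0]
        exact Equiv.sum_comp e s
      simp [this]
    have step1 := ih m hmJ hmS hm0
    have step2 : TransportLE p (mixture κ fun q => x q + m q)
        (mixture κ fun q => (x q + m q) + (s q - m q))
        (ENNReal.ofReal ((n : ℝ) ^ d * (2 * n * S)) * R) := by
      refine transportLE_line hp0 κ j (hκ j) (fun q => ?_) (fun q => ?_) (fun q => ?_)
      · rw [Finset.sum_sub_distrib]
        simp only [hmj]
        simp only [hm, Finset.sum_const, Finset.card_univ, Fintype.card_fin, nsmul_eq_mul]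
        field_simp
        ring
      · calc |s q - m q| ≤ |s q| + |m q| := abs_sub _ _
          _ ≤ 2 * S := by linarith [hs q, hmS q]
      · have h1 := hx q
        have h2 := (abs_le.1 (hmS q)).1
        have h3 : S ≤ n * S := le_mul_of_one_le_left hS hn
        linarith
    have step2' := step2.mono (T' := ((ENNReal.ofReal ((n : ℝ) ^ d * (2 * n * S)) * R) ^ (1 / p)) ^ p)
      (by rw [← ENNReal.rpow_mul, one_div_mul_cancel hp0.ne', ENNReal.rpow_one])
    have := step1.trans hp step2'
    convert this using 2
    · funext q
      ring
    · rw [Finset.card_insert_of_notMem hj]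
      push_cast
      ring

end Flow

/-- The half-open cube with lower corner `c` and side `s`. -/
def halfCube {d : ℕ} (c : EuclideanSpace ℝ (Fin d)) (s : ℝ) : Set (EuclideanSpace ℝ (Fin d)) :=
  {x | ∀ i, c i ≤ x i ∧ x i < c i + s}

/-- The closed cube with lower corner `c` and side `s`. -/
def closedCube {d : ℕ} (c : EuclideanSpace ℝ (Fin d)) (s : ℝ) : Set (EuclideanSpace ℝ (Fin d)) :=
  {x | ∀ i, c i ≤ x i ∧ x i ≤ c i + s}

/-- The lower corner of the subcube of index `q` in the regular grid of mesh `h` from `c`. -/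
def gridCorner {d n : ℕ} (c : EuclideanSpace ℝ (Fin d)) (h : ℝ) (q : Fin d → Fin n) :
    EuclideanSpace ℝ (Fin d) :=
  WithLp.toLp 2 fun i => c i + h * (q i : ℕ)

section Cubes

variable {d : ℕ} {c : EuclideanSpace ℝ (Fin d)} {s : ℝ}

theorem measurableSet_halfCube : MeasurableSet (halfCube c s) := by
  have : halfCube c s = ⋂ i, {x | c i ≤ x i ∧ x i < c i + s} := by
    ext x; simp [halfCube]
  rw [this]
  refine MeasurableSet.iInter fun i => ?_
  have hm : Measurable fun x : EuclideanSpace ℝ (Fin d) => x i := by fun_prop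
  exact (measurableSet_le measurable_const hm).inter (measurableSet_lt hm measurable_const)

theorem measurableSet_closedCube : MeasurableSet (closedCube c s) := by
  have : closedCube c s = ⋂ i, {x | c i ≤ x i ∧ x i ≤ c i + s} := by
    ext x; simp [closedCube]
  rw [this]
  refine MeasurableSet.iInter fun i => ?_
  have hm : Measurable fun x : EuclideanSpace ℝ (Fin d) => x i := by fun_prop
  exact (measurableSet_le measurable_const hm).inter (measurableSet_le hm measurable_const)

theorem halfCube_subset_closedCube : halfCube c s ⊆ closedCube c s :=
  fun _ hx i => ⟨(hx i).1, (hx i).2.le⟩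

theorem volume_closedCube (hs : 0 ≤ s) : (volume (closedCube c s)).toReal = s ^ d := by
  have h1 : closedCube c s = (MeasurableEquiv.toLp 2 (Fin d → ℝ)).symm ⁻¹'
      (Set.Icc (fun i => c i) (fun i => c i + s)) := by
    ext x
    simp [closedCube, Set.mem_Icc, Pi.le_def, forall_and]
  rw [h1, (EuclideanSpace.volume_preserving_symm_measurableEquiv_toLp (Fin d)).measure_preimage
    measurableSet_Icc.nullMeasurableSet, Real.volume_Icc_pi]
  simp [hs, ENNReal.toReal_ofReal]

theorem edist_le_of_forall_abs_le {x y : EuclideanSpace ℝ (Fin d)} {r : ℝ} (hr : 0 ≤ r)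
    (h : ∀ i, |x i - y i| ≤ r) : edist x y ≤ ENNReal.ofReal (√d * r) := by
  rw [edist_dist]
  apply ENNReal.ofReal_le_ofReal
  rw [EuclideanSpace.dist_eq]
  calc √(∑ i, dist (x i) (y i) ^ 2) ≤ √(∑ _i : Fin d, r ^ 2) := by
        apply Real.sqrt_le_sqrt
        refine Finset.sum_le_sum fun i _ => ?_
        have := h i
        rw [Real.dist_eq]
        gcongr
    _ = √d * r := by
        simp [Real.sqrt_mul, Real.sqrt_sq hr]

theorem edist_le_of_mem_closedCube (hs : 0 ≤ s) {x y : EuclideanSpace ℝ (Fin d)}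
    (hx : x ∈ closedCube c s) (hy : y ∈ closedCube c s) :
    edist x y ≤ ENNReal.ofReal (√d * s) := by
  refine edist_le_of_forall_abs_le hs fun i => ?_
  have h1 := hx i
  have h2 := hy i
  rw [abs_le]
  constructor <;> linarith

variable {n : ℕ}

theorem mem_halfCube_gridCorner_iff (hs : 0 < s) (hn : 0 < n) {x : EuclideanSpace ℝ (Fin d)}
    (hx : ∀ i, c i ≤ x i) (q : Fin d → Fin n) :
    x ∈ halfCube (gridCorner c (s / n) q) (s / n) ↔
      ∀ i, ⌊(x i - c i) / (s / n)⌋₊ = (q i : ℕ) := by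
  have hh : 0 < s / n := by positivity
  refine forall_congr' fun i => ?_
  have h0 : 0 ≤ (x i - c i) / (s / n) := div_nonneg (by linarith [hx i]) hh.le
  rw [Nat.floor_eq_iff h0, le_div_iff₀ hh, div_lt_iff₀ hh]
  simp only [gridCorner]
  constructor
  · rintro ⟨h1, h2⟩
    constructor <;> linarith
  · rintro ⟨h1, h2⟩
    constructor <;> linarith

theorem halfCube_gridCorner_subset (hs : 0 < s) (hn : 0 < n) (q : Fin d → Fin n) :
    halfCube (gridCorner c (s / n) q) (s / n) ⊆ halfCube c s := by
  intro x hx i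
  have hn' : (0 : ℝ) < n := by exact_mod_cast hn
  have hh : 0 < s / n := by positivity
  have h1 : ((q i : ℕ) : ℝ) + 1 ≤ n := by exact_mod_cast (q i).isLt
  have h2 := hx i
  simp only [gridCorner] at h2
  have h3 : s / n * ((q i : ℕ) + 1) ≤ s / n * n := by gcongr
  rw [div_mul_cancel₀ _ hn'.ne'] at h3
  have h4 : 0 ≤ s / n * (q i : ℕ) := by positivity
  constructor <;> linarith

theorem halfCube_eq_iUnion (hs : 0 < s) (hn : 0 < n) :
    halfCube c s = ⋃ q : Fin d → Fin n, halfCube (gridCorner c (s / n) q) (s / n) := by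
  have hn' : (0 : ℝ) < n := by exact_mod_cast hn
  have hh : 0 < s / n := by positivity
  refine Set.Subset.antisymm (fun x hx => ?_)
    (Set.iUnion_subset fun q => halfCube_gridCorner_subset hs hn q)
  have hlt : ∀ i, ⌊(x i - c i) / (s / n)⌋₊ < n := fun i => by
    rw [Nat.floor_lt' hn.ne', div_lt_iff₀ hh, mul_div_cancel₀ _ hn'.ne']
    linarith [(hx i).2]
  refine Set.mem_iUnion.2 ⟨fun i => ⟨_, hlt i⟩, ?_⟩
  rw [mem_halfCube_gridCorner_iff hs hn fun i => (hx i).1]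
  exact fun i => rfl

theorem pairwise_disjoint_halfCube_gridCorner (hs : 0 < s) (hn : 0 < n) :
    Pairwise (Function.onFun Disjoint
      fun q : Fin d → Fin n => halfCube (gridCorner c (s / n) q) (s / n)) := by
  intro q q' hqq
  rw [Function.onFun, Set.disjoint_left]
  intro x hx hx'
  have h0 : ∀ i, c i ≤ x i := fun i => (halfCube_gridCorner_subset hs hn q hx i).1
  rw [mem_halfCube_gridCorner_iff hs hn h0] at hx hx'
  exact hqq (funext fun i => Fin.ext ((hx i).symm.trans (hx' i)))

theorem restrict_halfCube (hs : 0 < s) (hn : 0 < n) (m : Measure (EuclideanSpace ℝ (Fin d))) :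
    m.restrict (halfCube c s) =
      ∑ q : Fin d → Fin n, m.restrict (halfCube (gridCorner c (s / n) q) (s / n)) := by
  rw [halfCube_eq_iUnion (c := c) hs hn, Measure.restrict_iUnion
    (pairwise_disjoint_halfCube_gridCorner hs hn) fun q => measurableSet_halfCube,
    Measure.sum_fintype]

theorem measure_halfCube (hs : 0 < s) (hn : 0 < n) (m : Measure (EuclideanSpace ℝ (Fin d))) :
    m (halfCube c s) = ∑ q : Fin d → Fin n, m (halfCube (gridCorner c (s / n) q) (s / n)) := by
  have := congrArg (fun m' => m' Set.univ) (restrict_halfCube (c := c) hs hn m)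
  simpa using this

/-- The cube of corner `c` and side `s > 0` lies in `[0, L]^d`. -/
def CubeInside (L : ℝ) (c : EuclideanSpace ℝ (Fin d)) (s : ℝ) : Prop :=
  0 < s ∧ ∀ i, 0 ≤ c i ∧ c i + s ≤ L

theorem CubeInside.gridCorner {L : ℝ} (h : CubeInside L c s) (hn : 0 < n)
    (q : Fin d → Fin n) : CubeInside L (gridCorner c (s / n) q) (s / n) := by
  have hn' : (0 : ℝ) < n := by exact_mod_cast hn
  have hs := h.1
  have hh : 0 < s / n := by positivity
  refine ⟨hh, fun i => ?_⟩
  have h1 : ((q i : ℕ) : ℝ) + 1 ≤ n := by exact_mod_cast (q i).isLt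
  have h3 : s / n * ((q i : ℕ) + 1) ≤ s / n * n := by gcongr
  rw [div_mul_cancel₀ _ hn'.ne'] at h3
  have h4 : 0 ≤ s / n * (q i : ℕ) := by positivity
  have h5 := h.2 i
  simp only [_root_.gridCorner]
  constructor <;> linarith

/-- Cubes inside `[0, L]^d` have null upper faces for a measure bounded by a multiple of the
volume on closed cubes. -/
theorem measure_closedCube_diff_halfCube {L A : ℝ}
    {ν : Measure (EuclideanSpace ℝ (Fin d))}
    (hν : ∀ c s, CubeInside L c s → ν (closedCube c s) ≤ ENNReal.ofReal (A * s ^ d))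
    (h : CubeInside L c s) : ν (closedCube c s \ halfCube c s) = 0 := by
  classical
  have hs := h.1
  have hsub : closedCube c s \ halfCube c s ⊆ ⋃ i, {x | x ∈ closedCube c s ∧ x i = c i + s} := by
    rintro x ⟨hx, hx'⟩
    obtain ⟨i, hi⟩ := not_forall.1 hx'
    exact Set.mem_iUnion.2 ⟨i, hx, le_antisymm (hx i).2 (not_lt.1 fun h => hi ⟨(hx i).1, h⟩)⟩
  refine measure_mono_null hsub (measure_iUnion_null fun i => ?_)
  have hbound : ∀ m : ℕ, ν {x | x ∈ closedCube c s ∧ x i = c i + s} ≤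
      ENNReal.ofReal (A * s ^ d / (m + 1 : ℕ)) := by
    intro m
    set n := m + 1 with hndef
    have hn : 0 < n := Nat.succ_pos m
    have hn' : (0 : ℝ) < n := by exact_mod_cast hn
    have hh : 0 < s / n := by positivity
    let I : Finset (Fin d → Fin n) :=
      Fintype.piFinset (Function.update (fun _ => Finset.univ) i {Fin.last m})
    have hcover : {x | x ∈ closedCube c s ∧ x i = c i + s} ⊆
        ⋃ q ∈ I, closedCube (gridCorner c (s / n) q) (s / n) := by
      rintro x ⟨hx, hxi⟩
      have hlt : ∀ j, min ⌊(x j - c j) / (s / n)⌋₊ m < n := fun j => by omega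
      refine Set.mem_iUnion₂.2 ⟨fun j => ⟨min ⌊(x j - c j) / (s / n)⌋₊ m, hlt j⟩, ?_, ?_⟩
      · rw [Fintype.mem_piFinset]
        intro j
        by_cases hj : j = i
        · subst hj
          rw [Function.update_self, Finset.mem_singleton]
          apply Fin.ext
          have : (x j - c j) / (s / n) = n := by
            rw [hxi]; field_simp; ring
          simp only [this, Nat.floor_natCast, Fin.val_last]
          omega
        · rw [Function.update_of_ne hj]
          exact Finset.mem_univ _
      · intro j
        have h0 : 0 ≤ (x j - c j) / (s / n) := div_nonneg (by linarith [(hx j).1]) hh.le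
        have h1 : (x j - c j) / (s / n) * (s / n) = x j - c j := div_mul_cancel₀ _ hh.ne'
        have h2 : (x j - c j) / (s / n) ≤ n := by
          rw [div_le_iff₀ hh, mul_div_cancel₀ _ hn'.ne']
          linarith [(hx j).2]
        simp only [gridCorner]
        set z := (x j - c j) / (s / n) with hz
        have h3 : ((min ⌊z⌋₊ m : ℕ) : ℝ) ≤ z :=
          (Nat.cast_le.2 (min_le_left _ _)).trans (Nat.floor_le h0)
        have h4 : z ≤ ((min ⌊z⌋₊ m : ℕ) : ℝ) + 1 := by
          rcases le_total ⌊z⌋₊ m with hle | hle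
          · rw [min_eq_left hle]; exact (Nat.lt_floor_add_one z).le
          · rw [min_eq_right hle]; exact_mod_cast h2
        have h5 : ((min ⌊z⌋₊ m : ℕ) : ℝ) * (s / n) ≤ z * (s / n) := by gcongr
        have h6 : z * (s / n) ≤ (((min ⌊z⌋₊ m : ℕ) : ℝ) + 1) * (s / n) := by gcongr
        constructor <;> nlinarith
    have hcard : (I.card : ℝ) * n = n ^ d := by
      have h1 : I.card = ∏ j, (Function.update (fun _ => (Finset.univ : Finset (Fin n))) i
          {Fin.last m} j).card := Fintype.card_piFinset _
      have h2 : ∏ j, (Function.update (fun _ => (Finset.univ : Finset (Fin n))) i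
          {Fin.last m} j).card = n ^ (d - 1) := by
        rw [← Finset.mul_prod_erase _ _ (Finset.mem_univ i), Function.update_self,
          Finset.card_singleton, one_mul, Finset.prod_congr rfl (g := fun _ => n)]
        · simp
        · intro j hj
          rw [Function.update_of_ne (Finset.ne_of_mem_erase hj)]
          simp
      have hd : d - 1 + 1 = d := by have := i.pos; omega
      rw [h1, h2]
      push_cast
      rw [← pow_succ, hd]
    calc ν {x | x ∈ closedCube c s ∧ x i = c i + s}
        ≤ ν (⋃ q ∈ I, closedCube (gridCorner c (s / n) q) (s / n)) := measure_mono hcover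
      _ ≤ ∑ q ∈ I, ν (closedCube (gridCorner c (s / n) q) (s / n)) :=
          measure_biUnion_finset_le _ _
      _ ≤ ∑ _q ∈ I, ENNReal.ofReal (A * (s / n) ^ d) :=
          Finset.sum_le_sum fun q _ => hν _ _ (h.gridCorner hn q)
      _ = ENNReal.ofReal (A * s ^ d / n) := by
          rw [Finset.sum_const, nsmul_eq_mul, ← ENNReal.ofReal_natCast,
            ← ENNReal.ofReal_mul (by positivity)]
          congr 1
          rw [div_pow, ← hcard]
          have hI : (I.card : ℝ) ≠ 0 := by
            intro h0
            rw [h0, zero_mul] at hcard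
            exact (pow_pos hn' d).ne hcard
          field_simp
  have hlim : Filter.Tendsto (fun m : ℕ => ENNReal.ofReal (A * s ^ d / (m + 1 : ℕ)))
      Filter.atTop (nhds 0) := by
    rw [← ENNReal.ofReal_zero]
    refine ENNReal.tendsto_ofReal ?_
    exact (Filter.tendsto_add_atTop_iff_nat 1).2 (tendsto_const_div_atTop_nhds_zero_nat _)
  exact le_antisymm (ge_of_tendsto' hlim hbound) zero_le

end Cubes

theorem mixture_apply_univ {ι X : Type*} [Fintype ι] [MeasurableSpace X] (κ : ι → Measure X)
    [∀ q, IsProbabilityMeasure (κ q)] {w : ι → ℝ} (hw : ∀ q, 0 ≤ w q) :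
    mixture κ w Set.univ = ENNReal.ofReal (∑ q, w q) := by
  rw [ENNReal.ofReal_sum_of_nonneg fun q _ => hw q]
  simp [mixture]

theorem mixture_apply_eq_zero {ι X : Type*} [Fintype ι] [MeasurableSpace X] {κ : ι → Measure X}
    {E : Set X} (hE : ∀ q, κ q E = 0) (w : ι → ℝ) : mixture κ w E = 0 := by
  simp [mixture, hE]

/-- Total-variation bound for the cost between two mixtures. -/
theorem transportLE_mixture {ι X : Type*} [Fintype ι] [PseudoEMetricSpace X] [MeasurableSpace X]
    [OpensMeasurableSpace X] [SecondCountableTopology X] {p : ℝ} (hp : 0 < p)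
    (κ : ι → Measure X) [∀ q, IsProbabilityMeasure (κ q)] {E : Set X}
    (hE : ∀ q, κ q Eᶜ = 0) {R : ℝ≥0∞} (hR : ∀ x ∈ E, ∀ y ∈ E, edist x y ≤ R)
    {x y : ι → ℝ} (hx : ∀ q, 0 ≤ x q) (hy : ∀ q, 0 ≤ y q) (hxy : ∑ q, x q = ∑ q, y q) :
    TransportLE p (mixture κ x) (mixture κ y) (R ^ p * ENNReal.ofReal (∑ q, |x q - y q|)) := by
  have e : ∀ x y : ι → ℝ, (∀ q, 0 ≤ x q) → (∀ q, 0 ≤ y q) →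
      mixture κ x = mixture κ (fun q => min (x q) (y q)) +
        mixture κ (fun q => max (x q - y q) 0) := by
    intro x y hx hy
    rw [← mixture_add κ (fun q => le_min (hx q) (hy q)) fun q => le_max_right _ _]
    congr 1
    funext q
    rcases le_total (x q) (y q) with h | h
    · rw [min_eq_left h, max_eq_right (by linarith)]; ring
    · rw [min_eq_right h, max_eq_left (by linarith)]; ring
  have e1 := e x y hx hy
  have e2 := e y x hy hx
  simp only [min_comm (y _)] at e2
  rw [e1, e2]
  have hdiff : ∑ q, max (x q - y q) 0 = ∑ q, max (y q - x q) 0 := by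
    have key : ∑ q, (max (x q - y q) 0 - max (y q - x q) 0) = ∑ q, (x q - y q) := by
      refine Finset.sum_congr rfl fun q _ => ?_
      rcases le_total (x q) (y q) with h | h
      · rw [max_eq_left (by linarith : (0:ℝ) ≤ y q - x q), max_eq_right (by linarith)]; ring
      · rw [max_eq_right (by linarith : y q - x q ≤ 0), max_eq_left (by linarith)]; ring
    rw [Finset.sum_sub_distrib, Finset.sum_sub_distrib] at key
    linarith
  have t := TransportLE.of_edist_le hp (μ := mixture κ fun q => max (x q - y q) 0)
    (ν := mixture κ fun q => max (y q - x q) 0)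
    (by rw [mixture_apply_univ κ fun q => le_max_right _ _,
          mixture_apply_univ κ fun q => le_max_right _ _, hdiff])
    (mixture_apply_eq_zero hE _) (mixture_apply_eq_zero hE _) hR
  refine ((TransportLE.refl hp _).add t).mono ?_
  rw [zero_add, mixture_apply_univ κ fun q => le_max_right _ _]
  gcongr with q
  exact max_le (le_abs_self _) (abs_nonneg _)

section Step

variable {d : ℕ}

/-- The index of the dyadic child containing a cell of the `2 * m`-grid. -/
def childIndex {m : ℕ} (q : Fin d → Fin (2 * m)) : Fin d → Fin 2 := fun i => (q i).divNat

theorem halfCube_subset_child {c : EuclideanSpace ℝ (Fin d)} {s : ℝ} (hs : 0 < s) {m : ℕ}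
    (hm : 0 < m) (q : Fin d → Fin (2 * m)) :
    halfCube (gridCorner c (s / (2 * m : ℕ)) q) (s / (2 * m : ℕ)) ⊆
      halfCube (gridCorner c (s / (2 : ℕ)) (childIndex q)) (s / (2 : ℕ)) := by
  intro x hx
  have hn : 0 < 2 * m := by omega
  have h0 : ∀ i, c i ≤ x i := fun i => (halfCube_gridCorner_subset hs hn q hx i).1
  rw [mem_halfCube_gridCorner_iff hs hn h0] at hx
  rw [mem_halfCube_gridCorner_iff hs two_pos h0]
  intro i
  have hm' : (0 : ℝ) < m := by exact_mod_cast hm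
  have : (x i - c i) / (s / (2 : ℕ)) = (x i - c i) / (s / (2 * m : ℕ)) / m := by
    push_cast
    field_simp
  rw [this, Nat.floor_div_natCast, hx i]
  rfl

theorem sum_smul_restrict_child {c : EuclideanSpace ℝ (Fin d)} {s : ℝ} (hs : 0 < s) {m : ℕ}
    (hm : 0 < m) (ν : Measure (EuclideanSpace ℝ (Fin d))) (w : (Fin d → Fin 2) → ℝ≥0∞) :
    ∑ i, w i • ν.restrict (halfCube (gridCorner c (s / (2 : ℕ)) i) (s / (2 : ℕ))) =
      ∑ q : Fin d → Fin (2 * m), w (childIndex q) •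
        ν.restrict (halfCube (gridCorner c (s / (2 * m : ℕ)) q) (s / (2 * m : ℕ))) := by
  classical
  have h : ∀ i, ν.restrict (halfCube (gridCorner c (s / (2 : ℕ)) i) (s / (2 : ℕ))) =
      ∑ q : Fin d → Fin (2 * m), if childIndex q = i then
        ν.restrict (halfCube (gridCorner c (s / (2 * m : ℕ)) q) (s / (2 * m : ℕ))) else 0 := by
    intro i
    have h1 : ν.restrict (halfCube (gridCorner c (s / (2 : ℕ)) i) (s / (2 : ℕ))) =
        (ν.restrict (halfCube c s)).restrict
          (halfCube (gridCorner c (s / (2 : ℕ)) i) (s / (2 : ℕ))) := by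
      rw [Measure.restrict_restrict measurableSet_halfCube,
        Set.inter_eq_left.2 (halfCube_gridCorner_subset hs two_pos i)]
    rw [h1, restrict_halfCube hs (by omega : 0 < 2 * m), ← Measure.sum_fintype,
      Measure.restrict_sum _ measurableSet_halfCube, Measure.sum_fintype]
    refine Finset.sum_congr rfl fun q _ => ?_
    rw [Measure.restrict_restrict measurableSet_halfCube]
    split_ifs with hq
    · rw [Set.inter_eq_right.2 (hq ▸ halfCube_subset_child hs hm q)]
    · rw [(Set.disjoint_iff_inter_eq_empty).1, Measure.restrict_empty]
      exact ((pairwise_disjoint_halfCube_gridCorner hs two_pos hq).mono_left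
        (halfCube_subset_child hs hm q)).symm
  simp only [h, Finset.smul_sum]
  rw [Finset.sum_comm]
  refine Finset.sum_congr rfl fun q _ => ?_
  simp [smul_ite]

theorem ofReal_mul_smul_cond {X : Type*} [MeasurableSpace X] {ν : Measure X} [IsFiniteMeasure ν]
    {s : Set X} (hs : ν s ≠ 0) {t : ℝ} (ht : 0 ≤ t) :
    ENNReal.ofReal (t * (ν s).toReal) • ProbabilityTheory.cond ν s =
      ENNReal.ofReal t • ν.restrict s := by
  rw [ProbabilityTheory.cond, smul_smul, ENNReal.ofReal_mul ht,
    ENNReal.ofReal_toReal (measure_ne_top _ _), mul_assoc,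
    ENNReal.mul_inv_cancel hs (measure_ne_top _ _), mul_one]

/-- The dimensional constant of the one-scale transport estimate. -/
def stepConst (d : ℕ) (p : ℝ) : ℝ :=
  ((d : ℝ) ^ p * 2 * (2 * √d) ^ p + √d ^ p) * 20 ^ (p - 1)

theorem stepConst_nonneg (d : ℕ) (p : ℝ) : 0 ≤ stepConst d p := by
  unfold stepConst
  positivity

theorem transportLE_of_density_close {p L a A : ℝ} (hp : 1 ≤ p) (ha : 0 < a) (haA : a ≤ A)
    {ν : Measure (EuclideanSpace ℝ (Fin d))} [IsFiniteMeasure ν]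
    (hν : ∀ c s, CubeInside L c s → ENNReal.ofReal (a * s ^ d) ≤ ν (halfCube c s) ∧
      ν (halfCube c s) ≤ ENNReal.ofReal (A * s ^ d))
    {c : EuclideanSpace ℝ (Fin d)} {s : ℝ} (hcs : CubeInside L c s)
    {ε w₀ : ℝ} {w : (Fin d → Fin 2) → ℝ} (hε : 0 < ε) (hw₀ : 0 ≤ w₀) (hw : ∀ i, 0 ≤ w i)
    (hw₀ε : |w₀ - 1| ≤ ε) (hwε : ∀ i, |w i - w₀| ≤ ε)
    (hsum : ∑ i, w i * (ν (halfCube (gridCorner c (s / (2 : ℕ)) i) (s / (2 : ℕ)))).toReal =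
      w₀ * (ν (halfCube c s)).toReal) :
    TransportLE p (ENNReal.ofReal w₀ • ν.restrict (halfCube c s))
      (∑ i, ENNReal.ofReal (w i) •
        ν.restrict (halfCube (gridCorner c (s / (2 : ℕ)) i) (s / (2 : ℕ))))
      (ENNReal.ofReal (stepConst d p * (ε * A * s ^ d * s ^ p * (ε * A / a) ^ (p - 1)))) := by
  have hp0 : 0 < p := zero_lt_one.trans_le hp
  have hs := hcs.1
  have hA : 0 < A := ha.trans_le haA
  have main : ∀ m : ℕ, 0 < m → ∃ (κ : (Fin d → Fin (2 * m)) → Measure (EuclideanSpace ℝ (Fin d)))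
      (b : (Fin d → Fin (2 * m)) → ℝ) (v : (Fin d → Fin (2 * m)) → ℝ),
      (∀ q, IsProbabilityMeasure (κ q)) ∧
      (∀ q, κ q (halfCube (gridCorner c (s / (2 * m : ℕ)) q) (s / (2 * m : ℕ)))ᶜ = 0) ∧
      (∀ q, a * (s / (2 * m : ℕ)) ^ d ≤ b q) ∧
      (∀ q, b q ≤ A * (s / (2 * m : ℕ)) ^ d) ∧
      (∀ q, 0 ≤ v q) ∧ (∀ q, |v q - w₀| ≤ ε) ∧
      ∑ q, v q * b q = ∑ q, w₀ * b q ∧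
      ENNReal.ofReal w₀ • ν.restrict (halfCube c s) = mixture κ (fun q => w₀ * b q) ∧
      ∑ i, ENNReal.ofReal (w i) •
        ν.restrict (halfCube (gridCorner c (s / (2 : ℕ)) i) (s / (2 : ℕ))) =
        mixture κ (fun q => v q * b q) := by
    intro m hm
    have hn : 0 < 2 * m := by omega
    have hn' : (0 : ℝ) < (2 * m : ℕ) := by exact_mod_cast hn
    have hb := fun q : Fin d → Fin (2 * m) => hν _ _ (hcs.gridCorner hn q)
    have hpos : ∀ q : Fin d → Fin (2 * m),
        ν (halfCube (gridCorner c (s / (2 * m : ℕ)) q) (s / (2 * m : ℕ))) ≠ 0 := fun q => by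
      have h1 : 0 < ENNReal.ofReal (a * (s / (2 * m : ℕ)) ^ d) :=
        ENNReal.ofReal_pos.2 (by positivity)
      exact (h1.trans_le (hb q).1).ne'
    have hmass : ∑ i, w i * (ν (halfCube (gridCorner c (s / (2 : ℕ)) i) (s / (2 : ℕ)))).toReal =
        ∑ q : Fin d → Fin (2 * m), w (childIndex q) *
          (ν (halfCube (gridCorner c (s / (2 * m : ℕ)) q) (s / (2 * m : ℕ)))).toReal := by
      have h1 := congrArg (fun M => (M Set.univ).toReal)
        (sum_smul_restrict_child (c := c) hs hm ν fun i => ENNReal.ofReal (w i))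
      simp only [Measure.coe_finsetSum, Finset.sum_apply, Measure.smul_apply, smul_eq_mul,
        Measure.restrict_apply_univ] at h1
      rw [ENNReal.toReal_sum fun i _ => ENNReal.mul_ne_top ENNReal.ofReal_ne_top
        (measure_ne_top _ _), ENNReal.toReal_sum fun i _ =>
        ENNReal.mul_ne_top ENNReal.ofReal_ne_top (measure_ne_top _ _)] at h1
      simpa only [ENNReal.toReal_mul, ENNReal.toReal_ofReal (hw _)] using h1
    refine ⟨fun q => ProbabilityTheory.cond ν
        (halfCube (gridCorner c (s / (2 * m : ℕ)) q) (s / (2 * m : ℕ))),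
      fun q => (ν (halfCube (gridCorner c (s / (2 * m : ℕ)) q) (s / (2 * m : ℕ)))).toReal,
      fun q => w (childIndex q), fun q => ProbabilityTheory.cond_isProbabilityMeasure (hpos q),
      fun q => ?_, fun q => ?_, fun q => ?_, fun q => hw _, fun q => hwε _, ?_, ?_, ?_⟩
    · rw [ProbabilityTheory.cond_apply measurableSet_halfCube]
      simp
    · exact (ENNReal.ofReal_le_iff_le_toReal (measure_ne_top _ _)).1 (hb q).1
    · exact ENNReal.toReal_le_of_le_ofReal (by positivity) (hb q).2
    · rw [← hmass, hsum, ← Finset.mul_sum, measure_halfCube hs hn,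
        ENNReal.toReal_sum fun i _ => measure_ne_top _ _]
    · rw [mixture, restrict_halfCube hs hn, Finset.smul_sum]
      exact Finset.sum_congr rfl fun q _ => (ofReal_mul_smul_cond (hpos q) hw₀).symm
    · rw [mixture, sum_smul_restrict_child hs hm ν fun i => ENNReal.ofReal (w i)]
      exact Finset.sum_congr rfl fun q _ => (ofReal_mul_smul_cond (hpos q) (hw _)).symm
  set θ : ℝ := ε * A / a with hθ
  have hθ0 : 0 < θ := by positivity
  rcases lt_or_ge (1 / (20 * θ)) 1 with hreg | hreg
  · obtain ⟨κ, b, v, hκ, hκE, hab, hbA, hv, hvε, hvb, e1, e2⟩ := main 1 one_pos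
    have hb0 : ∀ q, 0 ≤ b q := fun q => le_trans (by positivity) (hab q)
    rw [e1, e2]
    have hEc : ∀ q, κ q (closedCube c s)ᶜ = 0 := fun q =>
      measure_mono_null (Set.compl_subset_compl.2
        ((halfCube_gridCorner_subset hs (by norm_num) q).trans halfCube_subset_closedCube)) (hκE q)
    refine (transportLE_mixture hp0 κ hEc
      (fun x hx y hy => edist_le_of_mem_closedCube hs.le hx hy)
      (fun q => mul_nonneg hw₀ (hb0 q)) (fun q => mul_nonneg (hv q) (hb0 q)) hvb.symm).mono ?_
    rw [ENNReal.ofReal_rpow_of_nonneg (by positivity) hp0.le,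
      ← ENNReal.ofReal_mul (by positivity)]
    apply ENNReal.ofReal_le_ofReal
    have hsumle : ∑ q, |w₀ * b q - v q * b q| ≤ ε * A * s ^ d := by
      calc ∑ q, |w₀ * b q - v q * b q|
          ≤ ∑ _q : Fin d → Fin (2 * 1), ε * (A * (s / (2 * 1 : ℕ)) ^ d) := by
            refine Finset.sum_le_sum fun q _ => ?_
            rw [← sub_mul, abs_mul, abs_sub_comm, abs_of_nonneg (hb0 q)]
            exact mul_le_mul (hvε q) (hbA q) (hb0 q) hε.le
        _ = ε * A * s ^ d := by
            simp [div_pow]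
            field_simp
    have h20 : 1 ≤ (20 : ℝ) ^ (p - 1) * θ ^ (p - 1) := by
      rw [← Real.mul_rpow (by norm_num) hθ0.le]
      refine Real.one_le_rpow ?_ (by linarith)
      rw [div_lt_iff₀ (by positivity)] at hreg
      linarith
    calc (√d * s) ^ p * ∑ q, |w₀ * b q - v q * b q|
        ≤ (√d * s) ^ p * (ε * A * s ^ d) := by gcongr
      _ = √d ^ p * (ε * A * s ^ d * s ^ p) * 1 := by
          rw [Real.mul_rpow (by positivity) hs.le]; ring
      _ ≤ ((d : ℝ) ^ p * 2 * (2 * √d) ^ p + √d ^ p) * (ε * A * s ^ d * s ^ p) *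
            ((20 : ℝ) ^ (p - 1) * θ ^ (p - 1)) := by
          gcongr
          exact le_add_of_nonneg_left (by positivity)
      _ = stepConst d p * (ε * A * s ^ d * s ^ p * θ ^ (p - 1)) := by
          unfold stepConst; ring
  · set m := ⌊1 / (20 * θ)⌋₊ with hm
    have hm1 : 0 < m := Nat.floor_pos.2 hreg
    have hm1' : (1 : ℝ) ≤ m := by exact_mod_cast hm1
    have hmle : (m : ℝ) ≤ 1 / (20 * θ) := Nat.floor_le (by positivity)
    have hmlt : 1 / (20 * θ) < m + 1 := Nat.lt_floor_add_one _
    have hNZ : NeZero (2 * m) := ⟨by omega⟩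
    obtain ⟨κ, b, v, hκ, hκE, hab, hbA, hv, hvε, hvb, e1, e2⟩ := main m hm1
    have hb0 : ∀ q, 0 ≤ b q := fun q => le_trans (by positivity) (hab q)
    set h : ℝ := s / (2 * m : ℕ) with hh
    have hn' : (0 : ℝ) < (2 * m : ℕ) := by push_cast; linarith
    have hh0 : 0 < h := by positivity
    have hnh : (2 * m : ℕ) * h = s := mul_div_cancel₀ _ hn'.ne'
    have hhle : h ≤ 20 * θ * s := by
      have h1 : 1 ≤ 2 * m * (20 * θ) := by
        rw [div_lt_iff₀ (by positivity)] at hmlt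
        nlinarith
      have h2 : (2 * m : ℕ) * h * (20 * θ) = h * (2 * m * (20 * θ)) := by push_cast; ring
      rw [hnh] at h2
      nlinarith
    have hw₀half : 1 / 2 ≤ w₀ := by
      have h1 : ε ≤ θ := by
        rw [hθ, mul_div_assoc]
        exact le_mul_of_one_le_right hε.le ((one_le_div ha).2 haA)
      have h2 : θ ≤ 1 / 20 := by
        rw [le_div_iff₀ (by positivity)] at hreg
        linarith
      linarith [(abs_le.1 hw₀ε).1]
    have hadj : ∀ (j : Fin d) (q : Fin d → Fin (2 * m)), (q j).val + 1 < 2 * m →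
        TransportLE p (κ q) (κ (coordShift j q)) (ENNReal.ofReal (√d * (2 * h)) ^ p) ∧
        TransportLE p (κ (coordShift j q)) (κ q) (ENNReal.ofReal (√d * (2 * h)) ^ p) := by
      intro j q hq
      have hE1 : κ q (closedCube (gridCorner c h q) (2 * h))ᶜ = 0 := by
        refine measure_mono_null (Set.compl_subset_compl.2 fun x hx i => ?_) (hκE q)
        have := hx i
        constructor <;> linarith
      have hE2 : κ (coordShift j q) (closedCube (gridCorner c h q) (2 * h))ᶜ = 0 := by
        refine measure_mono_null (Set.compl_subset_compl.2 fun x hx i => ?_)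
          (hκE (coordShift j q))
        have h1 := hx i
        simp only [gridCorner, coordShift, Equiv.coe_fn_mk] at h1 ⊢
        by_cases hij : i = j
        · subst hij
          rw [Function.update_self, Fin.val_add_one_of_lt' hq] at h1
          push_cast at h1
          constructor <;> nlinarith
        · rw [Function.update_of_ne hij] at h1
          constructor <;> linarith
      have t := TransportLE.of_edist_le hp0 (μ := κ q) (ν := κ (coordShift j q)) (by simp) hE1 hE2
        (fun x hx y hy => edist_le_of_mem_closedCube (by positivity) hx hy)
      rw [measure_univ, mul_one] at t
      exact ⟨t, TransportLE.symm t⟩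
    have hS : 0 ≤ ε * (A * h ^ d) := by positivity
    have flow := transportLE_flow hp κ hadj hS (x := fun q => w₀ * b q) (fun q => ?_)
      Finset.univ (fun q => v q * b q - w₀ * b q) (fun j hj => absurd (Finset.mem_univ j) hj)
      (fun q => ?_) (by rw [Finset.sum_sub_distrib, hvb, sub_self])
    · rw [e1, e2]
      have e3 : (fun q => w₀ * b q + (v q * b q - w₀ * b q)) = fun q => v q * b q := by
        funext q; ring
      rw [e3] at flow
      refine flow.mono ?_
      have hfin : (d : ℝ) ^ p * ((2 * m : ℕ) ^ d * (2 * (2 * m : ℕ) * (ε * (A * h ^ d))) *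
          (√d * (2 * h)) ^ p) ≤ stepConst d p * (ε * A * s ^ d * s ^ p * θ ^ (p - 1)) := by
        have h1 : ((2 * m : ℕ) : ℝ) ^ d * h ^ d = s ^ d := by rw [← mul_pow, hnh]
        have h2 : h ^ p = h * h ^ (p - 1) := by
          rw [Real.rpow_sub_one hh0.ne']; field_simp
        have h3 : h ^ (p - 1) ≤ (20 * θ * s) ^ (p - 1) :=
          Real.rpow_le_rpow hh0.le hhle (by linarith)
        have h4 : s ^ p = s * s ^ (p - 1) := by
          rw [Real.rpow_sub_one hs.ne']; field_simp
        have h5 : (√d * (2 * h)) ^ p = (2 * √d) ^ p * (h * h ^ (p - 1)) := by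
          rw [← h2, ← Real.mul_rpow (by positivity) hh0.le]
          congr 1; ring
        rw [Real.mul_rpow (by positivity) hs.le, Real.mul_rpow (by norm_num) hθ0.le] at h3
        calc (d : ℝ) ^ p * ((2 * m : ℕ) ^ d * (2 * (2 * m : ℕ) * (ε * (A * h ^ d))) *
              (√d * (2 * h)) ^ p)
            = (d : ℝ) ^ p * 2 * (2 * √d) ^ p *
                (ε * A * (((2 * m : ℕ) : ℝ) ^ d * h ^ d) * (((2 * m : ℕ) * h) * h ^ (p - 1))) := by
              rw [h5]; ring
          _ ≤ (d : ℝ) ^ p * 2 * (2 * √d) ^ p *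
                (ε * A * s ^ d * (s * (20 ^ (p - 1) * θ ^ (p - 1) * s ^ (p - 1)))) := by
              rw [h1, hnh]
              gcongr
          _ = (d : ℝ) ^ p * 2 * (2 * √d) ^ p * 20 ^ (p - 1) *
                (ε * A * s ^ d * s ^ p * θ ^ (p - 1)) := by rw [h4]; ring
          _ ≤ stepConst d p * (ε * A * s ^ d * s ^ p * θ ^ (p - 1)) := by
              unfold stepConst
              gcongr
              exact le_add_of_nonneg_right (by positivity)
      refine le_trans (le_of_eq ?_) (ENNReal.ofReal_le_ofReal hfin)
      rw [ENNReal.mul_rpow_of_nonneg _ _ hp0.le, ← ENNReal.rpow_mul, one_div_mul_cancel hp0.ne',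
        ENNReal.rpow_one, ENNReal.ofReal_rpow_of_nonneg (by positivity) hp0.le,
        ← ENNReal.ofReal_mul (by positivity), Finset.card_univ, Fintype.card_fin,
        ← ENNReal.ofReal_natCast, ENNReal.ofReal_rpow_of_nonneg (by positivity) hp0.le,
        ← ENNReal.ofReal_mul (by positivity)]
    · have h1 : 20 * m * (ε * A) ≤ a := by
        rw [le_div_iff₀ (by positivity), hθ] at hmle
        have h2 : (m : ℝ) * (20 * (ε * A / a)) = 20 * m * (ε * A) / a := by ring
        rw [h2, div_le_one ha] at hmle
        exact hmle
      calc 5 * ((2 * m : ℕ) : ℝ) * (ε * (A * h ^ d))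
          = 1 / 2 * (20 * m * (ε * A) * h ^ d) := by push_cast; ring
        _ ≤ w₀ * b q := by
          refine mul_le_mul hw₀half (le_trans ?_ (hab q)) (by positivity) hw₀
          gcongr
    · rw [← sub_mul, abs_mul, abs_of_nonneg (hb0 q)]
      exact mul_le_mul (hvε q) (hbA q) (hb0 q) hε.le

end Step

section Step

variable {d : ℕ}

/-- One-scale estimate: redistributing the masses `m i` of the dyadic children of a cube. -/
theorem transportLE_children {p L a A : ℝ} (hp : 1 ≤ p) (ha : 0 < a) (haA : a ≤ A)
    {ν : Measure (EuclideanSpace ℝ (Fin d))} [IsFiniteMeasure ν]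
    (hν : ∀ c s, CubeInside L c s → ENNReal.ofReal (a * s ^ d) ≤ ν (halfCube c s) ∧
      ν (halfCube c s) ≤ ENNReal.ofReal (A * s ^ d))
    {c : EuclideanSpace ℝ (Fin d)} {s : ℝ} (hcs : CubeInside L c s)
    {m : (Fin d → Fin 2) → ℝ} (hm : ∀ i, 0 ≤ m i) :
    TransportLE p
      (∑ i, ENNReal.ofReal
        (m i / (ν (halfCube (gridCorner c (s / (2 : ℕ)) i) (s / (2 : ℕ)))).toReal) •
          ν.restrict (halfCube (gridCorner c (s / (2 : ℕ)) i) (s / (2 : ℕ))))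
      (ENNReal.ofReal ((∑ i, m i) / (ν (halfCube c s)).toReal) • ν.restrict (halfCube c s))
      (ENNReal.ofReal (stepConst d p * (2 ^ (d + 1)) ^ p * (A ^ p * a ^ (1 - 2 * p)) *
        s ^ (d + p - d * p) *
        (∑ i, |m i - (ν (halfCube (gridCorner c (s / (2 : ℕ)) i) (s / (2 : ℕ)))).toReal|) ^ p)) := by
  have hp0 : 0 < p := zero_lt_one.trans_le hp
  have hs := hcs.1
  have hA : 0 < A := ha.trans_le haA
  have h2 : (0 : ℝ) < (2 : ℕ) := by norm_num
  set b : (Fin d → Fin 2) → ℝ :=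
    fun i => (ν (halfCube (gridCorner c (s / (2 : ℕ)) i) (s / (2 : ℕ)))).toReal with hb
  set b₀ : ℝ := (ν (halfCube c s)).toReal with hb₀
  have hab : ∀ i, a * (s / (2 : ℕ)) ^ d ≤ b i := fun i =>
    (ENNReal.ofReal_le_iff_le_toReal (measure_ne_top _ _)).1
      (hν _ _ (hcs.gridCorner two_pos i)).1
  have hab₀ : a * s ^ d ≤ b₀ :=
    (ENNReal.ofReal_le_iff_le_toReal (measure_ne_top _ _)).1 (hν _ _ hcs).1
  have hbpos : ∀ i, 0 < b i := fun i => lt_of_lt_of_le (by positivity) (hab i)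
  have hb₀pos : 0 < b₀ := lt_of_lt_of_le (by positivity) hab₀
  have hbsum : ∑ i, b i = b₀ := by
    rw [hb₀, measure_halfCube hs two_pos, ENNReal.toReal_sum fun i _ => measure_ne_top _ _]
  set δ : ℝ := ∑ i, |m i - b i| with hδ
  have hδi : ∀ i, |m i - b i| ≤ δ := fun i =>
    Finset.single_le_sum (f := fun i => |m i - b i|) (fun i _ => abs_nonneg _) (Finset.mem_univ i)
  have hδ0 : 0 ≤ δ := Finset.sum_nonneg fun i _ => abs_nonneg _
  have hδsum : |∑ i, m i - b₀| ≤ δ := by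
    rw [← hbsum, ← Finset.sum_sub_distrib]
    exact Finset.abs_sum_le_sum_abs _ _
  rcases hδ0.eq_or_lt with h0 | hpos
  · have h1 : ∀ i, m i / b i = 1 := fun i => by
      have h3 := hδi i
      rw [← h0] at h3
      have h4 : m i = b i := by linarith [abs_nonpos_iff.1 h3]
      rw [h4, div_self (hbpos i).ne']
    have h3 : (∑ i, m i) / b₀ = 1 := by
      rw [← h0] at hδsum
      have h4 : ∑ i, m i = b₀ := by linarith [abs_nonpos_iff.1 hδsum]
      rw [h4, div_self hb₀pos.ne']
    simp only [hb] at h1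
    simp only [h1, h3]
    simp only [ENNReal.ofReal_one, one_smul]
    rw [← restrict_halfCube hs two_pos]
    exact (TransportLE.refl hp0 _).mono zero_le
  · set η : ℝ := 2 ^ d * δ / (a * s ^ d) with hη
    have hη0 : 0 < η := by positivity
    have h1 : ∀ i, |m i / b i - 1| ≤ η := fun i => by
      rw [div_sub_one (hbpos i).ne', abs_div, abs_of_pos (hbpos i)]
      calc |m i - b i| / b i ≤ δ / (a * (s / (2 : ℕ)) ^ d) := by
            gcongr
            · exact hδi i
            · exact hab i
        _ = η := by
            rw [hη, div_pow]; push_cast; field_simp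
    have h3 : |(∑ i, m i) / b₀ - 1| ≤ η := by
      rw [div_sub_one hb₀pos.ne', abs_div, abs_of_pos hb₀pos]
      calc |∑ i, m i - b₀| / b₀ ≤ δ / (a * s ^ d) := by gcongr
        _ ≤ η := by
            rw [hη]
            gcongr
            exact le_mul_of_one_le_left hδ0 (one_le_pow₀ one_le_two)
    have t := transportLE_of_density_close hp ha haA hν hcs (ε := 2 * η)
      (w₀ := (∑ i, m i) / b₀) (w := fun i => m i / b i) (by positivity)
      (div_nonneg (Finset.sum_nonneg fun i _ => hm i) hb₀pos.le)
      (fun i => div_nonneg (hm i) (hbpos i).le) (by linarith)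
      (fun i => by
        have h4 := abs_sub (m i / b i - 1) ((∑ i, m i) / b₀ - 1)
        rw [sub_sub_sub_cancel_right] at h4
        linarith [h1 i])
      (by
        rw [div_mul_cancel₀ _ hb₀pos.ne']
        exact Finset.sum_congr rfl fun i _ => div_mul_cancel₀ _ (hbpos i).ne')
    refine (TransportLE.symm t).mono (ENNReal.ofReal_le_ofReal (le_of_eq ?_))
    have e1 : 2 * η = 2 ^ (d + 1) * δ / (a * s ^ d) := by rw [hη, pow_succ]; ring
    have e2 : ∀ x : ℝ, 0 < x → x ^ p = x * x ^ (p - 1) := fun x hx => by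
      rw [Real.rpow_sub_one hx.ne']; field_simp
    have e3 : 2 * η * A * s ^ d * s ^ p * (2 * η * A / a) ^ (p - 1) =
        (2 * η * A) ^ p * (s ^ d * s ^ p) * a ^ (1 - p) := by
      rw [e2 (2 * η * A) (by positivity), Real.div_rpow (by positivity) ha.le,
        show 1 - p = -(p - 1) by ring, Real.rpow_neg ha.le]
      ring
    have e4 : a ^ (1 - 2 * p) = a ^ (1 - p) / a ^ p := by
      rw [← Real.rpow_sub ha]; congr 1; ring
    have e5 : s ^ (d + p - d * p) = s ^ d * s ^ p / (s ^ d) ^ p := by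
      rw [Real.rpow_sub hs, Real.rpow_add hs, Real.rpow_natCast, ← Real.rpow_natCast_mul hs.le]
    rw [e3, e4, e5, e1, Real.mul_rpow (by positivity) hA.le, Real.div_rpow (by positivity)
      (by positivity), Real.mul_rpow (by positivity) hδ0, Real.mul_rpow ha.le (by positivity)]
    field_simp

end Step

section Induction

/-- Minkowski's inequality for integrals with bounds of the form `v * x ^ p`. -/
theorem lintegral_add_rpow_le {Ω : Type*} [MeasurableSpace Ω] {P : Measure Ω} {p : ℝ} (hp : 1 ≤ p)
    {Z X : Ω → ℝ≥0∞} (hZ : Measurable Z) (hX : Measurable X) {v x y : ℝ≥0∞}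
    (hZx : ∫⁻ ω, Z ω ^ p ∂P ≤ v * x ^ p) (hXy : ∫⁻ ω, X ω ^ p ∂P ≤ v * y ^ p) :
    ∫⁻ ω, (Z ω + X ω) ^ p ∂P ≤ v * (x + y) ^ p := by
  have hp0 : 0 < p := zero_lt_one.trans_le hp
  have h1 := ENNReal.lintegral_Lp_add_le (μ := P) hZ.aemeasurable hX.aemeasurable hp
  have hroot : ∀ {I u : ℝ≥0∞}, I ≤ v * u ^ p → I ^ (1 / p) ≤ v ^ (1 / p) * u := fun {I u} h => by
    calc I ^ (1 / p) ≤ (v * u ^ p) ^ (1 / p) := by gcongr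
      _ = v ^ (1 / p) * u := by
        rw [ENNReal.mul_rpow_of_nonneg _ _ (by positivity), ← ENNReal.rpow_mul,
          mul_one_div_cancel hp0.ne', ENNReal.rpow_one]
  have h2 := h1.trans (add_le_add (hroot hZx) (hroot hXy))
  rw [← mul_add] at h2
  calc ∫⁻ ω, (Z ω + X ω) ^ p ∂P = ((∫⁻ ω, (Z + X) ω ^ p ∂P) ^ (1 / p)) ^ p := by
        rw [← ENNReal.rpow_mul, one_div_mul_cancel hp0.ne', ENNReal.rpow_one]; rfl
    _ ≤ (v ^ (1 / p) * (x + y)) ^ p := by gcongr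
    _ = v * (x + y) ^ p := by
        rw [ENNReal.mul_rpow_of_nonneg _ _ hp0.le, ← ENNReal.rpow_mul,
          one_div_mul_cancel hp0.ne', ENNReal.rpow_one]

variable {Ω : Type*} [MeasurableSpace Ω] {P : Measure Ω} {d : ℕ}

/-- Expected cost of the redistribution between the dyadic children of a cube of side `s`. -/
theorem lintegral_children_le {p D Λ G s : ℝ} (hd : 0 < d) (hp : 1 ≤ p) (hD : 0 ≤ D) (hΛ : 0 ≤ Λ)
    (hDΛ : D * (2 ^ d) ^ p ≤ Λ ^ p) (hG : 0 ≤ G) (hs : 0 < s)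
    {m : (Fin d → Fin 2) → Ω → ℝ} (hm : ∀ i, Measurable (m i)) {b : (Fin d → Fin 2) → ℝ}
    (hmom : ∀ i, ∫⁻ ω, ENNReal.ofReal (|m i ω - b i| ^ p) ∂P ≤
      ENNReal.ofReal (((s / (2 : ℕ)) ^ d) ^ (p * (d - 1) / d) * G ^ p)) :
    ∫⁻ ω, ENNReal.ofReal (D * s ^ (d + p - d * p) * (∑ i, |m i ω - b i|) ^ p) ∂P ≤
      ENNReal.ofReal (s ^ d) * ENNReal.ofReal (Λ * G) ^ p := by
  have hp0 : 0 < p := zero_lt_one.trans_le hp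
  have hd' : (1 : ℝ) ≤ d := by exact_mod_cast hd
  set E : ℝ := D * s ^ (d + p - d * p) * (2 ^ d) ^ (p - 1) with hE
  have hE0 : 0 ≤ E := by positivity
  have h1 : ∀ ω, ENNReal.ofReal (D * s ^ (d + p - d * p) * (∑ i, |m i ω - b i|) ^ p) ≤
      ENNReal.ofReal E * ∑ i, ENNReal.ofReal (|m i ω - b i| ^ p) := fun ω => by
    rw [← ENNReal.ofReal_sum_of_nonneg fun i _ => by positivity, ← ENNReal.ofReal_mul hE0]
    apply ENNReal.ofReal_le_ofReal
    have h2 := Real.rpow_sum_le_const_mul_sum_rpow Finset.univ (fun i => m i ω - b i) hp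
    simp only [Finset.card_univ, Fintype.card_pi, Fintype.card_fin, Finset.prod_const] at h2
    push_cast at h2
    calc D * s ^ (d + p - d * p) * (∑ i, |m i ω - b i|) ^ p
        ≤ D * s ^ (d + p - d * p) * ((2 ^ d) ^ (p - 1) * ∑ i, |m i ω - b i| ^ p) := by gcongr
      _ = E * ∑ i, |m i ω - b i| ^ p := by rw [hE]; ring
  have hmeas : ∀ i, Measurable fun ω => ENNReal.ofReal (|m i ω - b i| ^ p) := fun i => by
    have := hm i
    fun_prop
  have hs2 : ((s / (2 : ℕ)) ^ d) ^ (p * (d - 1) / d) ≤ s ^ (p * d - p) := by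
    calc ((s / (2 : ℕ)) ^ d) ^ (p * (d - 1) / d) ≤ (s ^ d) ^ (p * (d - 1) / d) := by
          have : 0 ≤ p * (d - 1) / d := by
            have : (0 : ℝ) ≤ d - 1 := by linarith
            positivity
          gcongr
          exact div_le_self hs.le (by norm_num)
      _ = s ^ (p * d - p) := by
          rw [← Real.rpow_natCast_mul hs.le]
          congr 1
          field_simp
  calc _ ≤ ∫⁻ ω, ENNReal.ofReal E * ∑ i, ENNReal.ofReal (|m i ω - b i| ^ p) ∂P := lintegral_mono h1
    _ = ENNReal.ofReal E * ∑ i, ∫⁻ ω, ENNReal.ofReal (|m i ω - b i| ^ p) ∂P := by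
        rw [lintegral_const_mul _ (Finset.measurable_fun_sum _ fun i _ => hmeas i),
          lintegral_finsetSum _ fun i _ => hmeas i]
    _ ≤ ENNReal.ofReal E * ∑ _i : Fin d → Fin 2, ENNReal.ofReal (s ^ (p * d - p) * G ^ p) := by
        gcongr with i
        refine (hmom i).trans (ENNReal.ofReal_le_ofReal ?_)
        gcongr
    _ = ENNReal.ofReal (E * (2 ^ d * (s ^ (p * d - p) * G ^ p))) := by
        rw [ENNReal.ofReal_mul hE0, ENNReal.ofReal_mul (p := 2 ^ d) (by positivity)]
        simp [ENNReal.ofReal_pow]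
    _ ≤ ENNReal.ofReal (s ^ d * (Λ * G) ^ p) := by
        apply ENNReal.ofReal_le_ofReal
        have e1 : s ^ (d + p - d * p) * s ^ (p * d - p) = s ^ d := by
          rw [← Real.rpow_add hs, ← Real.rpow_natCast]; congr 1; ring
        have e2 : ((2 : ℝ) ^ d) ^ (p - 1) * 2 ^ d = (2 ^ d) ^ p := by
          rw [Real.rpow_sub_one (by positivity)]; field_simp
        calc E * (2 ^ d * (s ^ (p * d - p) * G ^ p))
            = (s ^ (d + p - d * p) * s ^ (p * d - p)) * (D * ((2 ^ d) ^ (p - 1) * 2 ^ d)) * G ^ p := by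
              rw [hE]; ring
          _ ≤ s ^ d * Λ ^ p * G ^ p := by
              rw [e1, e2]; gcongr
          _ = s ^ d * (Λ * G) ^ p := by rw [Real.mul_rpow hΛ hG]; ring
    _ = _ := by
        rw [ENNReal.ofReal_mul (by positivity), ENNReal.ofReal_rpow_of_nonneg (by positivity) hp0.le]

/-- Multiscale estimate on a cube of side `2 ^ k * ℓ`. -/
theorem exists_transportLE_dyadic {p L a A Λ ℓ : ℝ} (hd : 0 < d) (hp : 1 ≤ p) (ha : 0 < a)
    (haA : a ≤ A) (hΛ : 0 ≤ Λ)
    (hΛ₁ : stepConst d p * (2 ^ (d + 1)) ^ p * (A ^ p * a ^ (1 - 2 * p)) * (2 ^ d) ^ p ≤ Λ ^ p)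
    (hΛ₂ : (√d * ℓ) ^ p * A ≤ Λ ^ p) (hℓ : 0 < ℓ)
    {μ : Ω → Measure (EuclideanSpace ℝ (Fin d))} [∀ ω, IsFiniteMeasure (μ ω)]
    (hmeas : ∀ B : Set (EuclideanSpace ℝ (Fin d)), MeasurableSet B → Measurable fun ω => μ ω B)
    {ν : Measure (EuclideanSpace ℝ (Fin d))} [IsFiniteMeasure ν]
    (hνμ : ∀ B : Set (EuclideanSpace ℝ (Fin d)), MeasurableSet B → ν B = ∫⁻ ω, μ ω B ∂P)
    (hν : ∀ c s, CubeInside L c s → ENNReal.ofReal (a * s ^ d) ≤ ν (halfCube c s) ∧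
      ν (halfCube c s) ≤ ENNReal.ofReal (A * s ^ d))
    {g : ℝ → ℝ} (hg : ∀ y, 1 ≤ y → 0 < g y)
    (hmom : ∀ c s, CubeInside L c s → 1 ≤ s →
      ∫⁻ ω, ENNReal.ofReal (|(μ ω (halfCube c s)).toReal - (ν (halfCube c s)).toReal| ^ p) ∂P ≤
        ENNReal.ofReal ((s ^ d) ^ (p * (d - 1) / d) * g (s ^ d) ^ p)) (k : ℕ)
    (hk : k = 0 ∨ 1 ≤ ℓ) (c : EuclideanSpace ℝ (Fin d)) (hc : CubeInside L c (2 ^ k * ℓ)) :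
    ∃ Y : Ω → ℝ≥0∞, Measurable Y ∧
      (∀ ω, TransportLE p ((μ ω).restrict (halfCube c (2 ^ k * ℓ)))
        (ENNReal.ofReal ((μ ω (halfCube c (2 ^ k * ℓ))).toReal /
          (ν (halfCube c (2 ^ k * ℓ))).toReal) • ν.restrict (halfCube c (2 ^ k * ℓ)))
        (Y ω ^ p)) ∧
      ∫⁻ ω, Y ω ^ p ∂P ≤ ENNReal.ofReal ((2 ^ k * ℓ) ^ d) *
        ENNReal.ofReal (Λ * (1 + ∑ j ∈ Finset.range k, g ((2 ^ j * ℓ) ^ d))) ^ p := by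
  have hp0 : 0 < p := zero_lt_one.trans_le hp
  have hA : 0 < A := ha.trans_le haA
  induction k generalizing c with
  | zero =>
    simp only [pow_zero, one_mul] at hc ⊢
    have hνne : ν (halfCube c ℓ) ≠ 0 :=
      (lt_of_lt_of_le (ENNReal.ofReal_pos.2 (by positivity)) (hν _ _ hc).1).ne'
    refine ⟨fun ω => ENNReal.ofReal (√d * ℓ) * μ ω (halfCube c ℓ) ^ (1 / p),
      ((hmeas _ measurableSet_halfCube).pow_const _).const_mul _, fun ω => ?_, ?_⟩
    · have := Measure.smul_finite (ν.restrict (halfCube c ℓ)) (ENNReal.ofReal_ne_top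
        (r := (μ ω (halfCube c ℓ)).toReal / (ν (halfCube c ℓ)).toReal))
      have t := TransportLE.of_edist_le hp0 (μ := (μ ω).restrict (halfCube c ℓ))
        (ν := ENNReal.ofReal ((μ ω (halfCube c ℓ)).toReal / (ν (halfCube c ℓ)).toReal) •
          ν.restrict (halfCube c ℓ)) (E := halfCube c ℓ) (R := ENNReal.ofReal (√d * ℓ))
        (by
          rw [Measure.smul_apply, Measure.restrict_apply_univ, Measure.restrict_apply_univ,
            smul_eq_mul, ← ENNReal.toReal_div, ENNReal.ofReal_toReal
              (ENNReal.div_ne_top (measure_ne_top _ _) hνne),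
            ENNReal.div_mul_cancel hνne (measure_ne_top _ _)])
        (by simp [Measure.restrict_apply measurableSet_halfCube.compl])
        (by simp [Measure.restrict_apply measurableSet_halfCube.compl])
        (fun x hx y hy => edist_le_of_mem_closedCube hℓ.le (halfCube_subset_closedCube hx)
          (halfCube_subset_closedCube hy))
      refine t.mono (le_of_eq ?_)
      rw [Measure.restrict_apply_univ, ENNReal.mul_rpow_of_nonneg _ _ hp0.le, ← ENNReal.rpow_mul,
        one_div_mul_cancel hp0.ne', ENNReal.rpow_one]
    · have e1 : ∀ ω, (ENNReal.ofReal (√d * ℓ) * μ ω (halfCube c ℓ) ^ (1 / p)) ^ p =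
          ENNReal.ofReal (√d * ℓ) ^ p * μ ω (halfCube c ℓ) := fun ω => by
        rw [ENNReal.mul_rpow_of_nonneg _ _ hp0.le, ← ENNReal.rpow_mul,
          one_div_mul_cancel hp0.ne', ENNReal.rpow_one]
      simp only [e1, Finset.range_zero, Finset.sum_empty, add_zero, mul_one]
      rw [lintegral_const_mul _ (hmeas _ measurableSet_halfCube), ← hνμ _ measurableSet_halfCube,
        ENNReal.ofReal_rpow_of_nonneg (by positivity) hp0.le, ENNReal.ofReal_rpow_of_nonneg hΛ hp0.le]
      calc _ ≤ ENNReal.ofReal ((√d * ℓ) ^ p) * ENNReal.ofReal (A * ℓ ^ d) := by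
            gcongr
            exact (hν _ _ hc).2
        _ = ENNReal.ofReal (ℓ ^ d) * ENNReal.ofReal ((√d * ℓ) ^ p * A) := by
            rw [← ENNReal.ofReal_mul (by positivity), ← ENNReal.ofReal_mul (by positivity)]
            congr 1; ring
        _ ≤ _ := by gcongr
  | succ k ih =>
    have hℓ1 : 1 ≤ ℓ := hk.resolve_left (Nat.succ_ne_zero k)
    have hs2 : (2 : ℝ) ^ (k + 1) * ℓ / (2 : ℕ) = 2 ^ k * ℓ := by
      rw [pow_succ]; push_cast; ring
    have h1s : ∀ j : ℕ, (1 : ℝ) ≤ 2 ^ j * ℓ := fun j =>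
      one_le_mul_of_one_le_of_one_le (one_le_pow₀ one_le_two) hℓ1
    have hgj : ∀ j : ℕ, 0 < g ((2 ^ j * ℓ) ^ d) := fun j => hg _ (one_le_pow₀ (h1s j))
    have hcube : ∀ i : Fin d → Fin 2,
        CubeInside L (gridCorner c (2 ^ k * ℓ) i) (2 ^ k * ℓ) := fun i => by
      have := hc.gridCorner two_pos i
      rwa [hs2] at this
    choose Y hYm hYt hYi using fun i => ih (Or.inr hℓ1) _ (hcube i)
    have hchild := fun ω => transportLE_children hp ha haA hν hc
      (m := fun i => (μ ω (halfCube (gridCorner c (2 ^ k * ℓ) i) (2 ^ k * ℓ))).toReal)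
      fun i => ENNReal.toReal_nonneg
    have hexp := lintegral_children_le (P := P) hd hp
      (D := stepConst d p * (2 ^ (d + 1)) ^ p * (A ^ p * a ^ (1 - 2 * p)))
      (by have := stepConst_nonneg d p; positivity) hΛ hΛ₁ (hgj k).le hc.1
      (m := fun i ω => (μ ω (halfCube (gridCorner c (2 ^ k * ℓ) i) (2 ^ k * ℓ))).toReal)
      (fun i => (hmeas _ measurableSet_halfCube).ennreal_toReal)
      (b := fun i => (ν (halfCube (gridCorner c (2 ^ k * ℓ) i) (2 ^ k * ℓ))).toReal)
      (fun i => by rw [hs2]; exact hmom _ _ (hcube i) (h1s k))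
    have hgrid := fun m => restrict_halfCube (c := c) hc.1 (n := 2) two_pos m
    have hmass : ∀ ω, ∑ i, (μ ω (halfCube (gridCorner c (2 ^ k * ℓ) i) (2 ^ k * ℓ))).toReal =
        (μ ω (halfCube c (2 ^ (k + 1) * ℓ))).toReal := fun ω => by
      rw [measure_halfCube hc.1 (n := 2) two_pos, hs2,
        ENNReal.toReal_sum fun i _ => measure_ne_top _ _]
    simp only [hs2, hmass] at hchild hgrid
    set T : Ω → ℝ≥0∞ := fun ω => ENNReal.ofReal
      (stepConst d p * (2 ^ (d + 1)) ^ p * (A ^ p * a ^ (1 - 2 * p)) *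
        (2 ^ (k + 1) * ℓ) ^ (d + p - d * p) *
        (∑ i, |(μ ω (halfCube (gridCorner c (2 ^ k * ℓ) i) (2 ^ k * ℓ))).toReal -
          (ν (halfCube (gridCorner c (2 ^ k * ℓ) i) (2 ^ k * ℓ))).toReal|) ^ p) with hT
    have hTm : Measurable T := by
      have := fun i : Fin d → Fin 2 => (hmeas (halfCube (gridCorner c (2 ^ k * ℓ) i) (2 ^ k * ℓ))
        measurableSet_halfCube).ennreal_toReal
      fun_prop
    have hroot : ∀ x : ℝ≥0∞, (x ^ (1 / p)) ^ p = x := fun x => by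
      rw [← ENNReal.rpow_mul, one_div_mul_cancel hp0.ne', ENNReal.rpow_one]
    have hYm' : Measurable fun ω => ∑ i, Y i ω ^ p :=
      Finset.measurable_fun_sum _ fun i _ => (hYm i).pow_const _
    refine ⟨fun ω => (∑ i, Y i ω ^ p) ^ (1 / p) + T ω ^ (1 / p),
      (hYm'.pow_const _).add (hTm.pow_const _), fun ω => ?_, ?_⟩
    · have t1 := TransportLE.sum Finset.univ fun i _ => hYt i ω
      rw [← hgrid (μ ω), ← hroot (∑ i, Y i ω ^ p)] at t1
      have t2 := hchild ω
      rw [show ENNReal.ofReal _ = T ω from rfl, ← hroot (T ω)] at t2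
      have hfin : IsFiniteMeasure (∑ i : Fin d → Fin 2, ENNReal.ofReal
          ((μ ω (halfCube (gridCorner c (2 ^ k * ℓ) i) (2 ^ k * ℓ))).toReal /
            (ν (halfCube (gridCorner c (2 ^ k * ℓ) i) (2 ^ k * ℓ))).toReal) •
          ν.restrict (halfCube (gridCorner c (2 ^ k * ℓ) i) (2 ^ k * ℓ))) := by
        refine ⟨?_⟩
        rw [Measure.finsetSum_apply]
        exact ENNReal.sum_lt_top.2 fun i _ =>
          ENNReal.mul_lt_top ENNReal.ofReal_lt_top (measure_lt_top _ _)
      exact TransportLE.trans hp t1 t2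
    · rw [Finset.sum_range_succ, ← add_assoc, mul_add Λ, ENNReal.ofReal_add
        (mul_nonneg hΛ (add_nonneg zero_le_one (Finset.sum_nonneg fun j _ => (hgj j).le)))
        (mul_nonneg hΛ (hgj k).le)]
      refine lintegral_add_rpow_le hp (hYm'.pow_const _) (hTm.pow_const _) ?_ ?_
      · simp only [hroot]
        rw [lintegral_finsetSum _ fun i _ => (hYm i).pow_const _]
        calc _ ≤ ∑ _i : Fin d → Fin 2, _ := Finset.sum_le_sum fun i _ => hYi i
          _ = _ := by
            rw [Finset.sum_const, nsmul_eq_mul, ← mul_assoc]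
            congr 1
            simp only [Finset.card_univ, Fintype.card_pi, Fintype.card_fin, Finset.prod_const]
            rw [← ENNReal.ofReal_natCast, ← ENNReal.ofReal_mul (by positivity)]
            congr 1
            push_cast
            rw [pow_succ]
            ring
      · simp only [hroot]
        exact hexp

end Induction

section Sums

/-- A sum of lower bounds of `g` over successive intervals of ratio at least `2` is controlled by
the integral of `g y / y`. -/
theorem sum_le_two_mul_integral {g : ℝ → ℝ} (hg : ∀ y, 1 ≤ y → 0 < g y)
    (hInt : ∀ u v, 1 ≤ u → 1 ≤ v → IntervalIntegrable (fun y => g y / y) volume u v)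
    {x : ℕ → ℝ} (hx₀ : 1 ≤ x 0) (hx : ∀ j, 2 * x j ≤ x (j + 1)) {G : ℕ → ℝ} (hG₀ : ∀ j, 0 ≤ G j)
    (hG : ∀ j, ∀ y ∈ Set.Icc (x j) (x (j + 1)), G j ≤ g y) (k : ℕ) :
    ∑ j ∈ Finset.range k, G j ≤ 2 * ∫ y in (1 : ℝ)..x k, g y / y := by
  have hx1 : ∀ j, 1 ≤ x j := fun j => by
    induction j with
    | zero => exact hx₀
    | succ j ih => linarith [hx j]
  induction k with
  | zero =>
    rw [Finset.range_zero, Finset.sum_empty]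
    refine mul_nonneg zero_le_two (intervalIntegral.integral_nonneg hx₀ fun y hy => ?_)
    exact div_nonneg (hg y hy.1).le (zero_le_one.trans hy.1)
  | succ k ih =>
    have hxk : 0 < x k := zero_lt_one.trans_le (hx1 k)
    have hle : x k ≤ x (k + 1) := by linarith [hx k]
    rw [Finset.sum_range_succ, ← intervalIntegral.integral_add_adjacent_intervals
      (hInt 1 (x k) le_rfl (hx1 k)) (hInt _ _ (hx1 k) (hx1 (k + 1))), mul_add]
    refine add_le_add ih ?_
    have h1 : ∫ y in x k..x (k + 1), G k * y⁻¹ ≤ ∫ y in x k..x (k + 1), g y / y := by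
      refine intervalIntegral.integral_mono_on hle ?_ (hInt _ _ (hx1 k) (hx1 (k + 1))) ?_
      · refine (intervalIntegral.intervalIntegrable_inv (fun y hy => ?_) continuousOn_id).const_mul _
        rw [Set.uIcc_of_le hle] at hy
        exact (hxk.trans_le hy.1).ne'
      · intro y hy
        rw [div_eq_mul_inv]
        have := hxk.trans_le hy.1
        gcongr
        exact hG k y hy
    rw [intervalIntegral.integral_const_mul, integral_inv_of_pos hxk (hxk.trans_le hle)] at h1
    have h2 : Real.log 2 ≤ Real.log (x (k + 1) / x k) :=
      Real.log_le_log two_pos ((le_div_iff₀ hxk).2 (hx k))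
    have h3 : G k * (1 / 2) ≤ G k * Real.log (x (k + 1) / x k) :=
      mul_le_mul_of_nonneg_left (by linarith [Real.log_two_gt_d9]) (hG₀ k)
    linarith

theorem intervalIntegrable_div_id {g : ℝ → ℝ}
    (hg : MonotoneOn g (Set.Ici 1) ∨ AntitoneOn g (Set.Ici 1)) {u v : ℝ} (hu : 1 ≤ u)
    (hv : 1 ≤ v) : IntervalIntegrable (fun y => g y / y) volume u v := by
  have hsub : Set.uIcc u v ⊆ Set.Ici 1 := fun y hy => (le_min hu hv).trans hy.1
  have h1 : IntervalIntegrable g volume u v := hg.elim (fun h => (h.mono hsub).intervalIntegrable)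
    fun h => (h.mono hsub).intervalIntegrable
  simp only [div_eq_mul_inv]
  exact h1.mul_continuousOn (continuousOn_id.inv₀ fun y hy =>
    (zero_lt_one.trans_le (hsub hy)).ne')

theorem sum_dyadic_le_two_mul_integral {g : ℝ → ℝ} (hg : ∀ y, 1 ≤ y → 0 < g y)
    (hmono : MonotoneOn g (Set.Ici 1) ∨ AntitoneOn g (Set.Ici 1)) {d : ℕ} (hd : 0 < d) {ℓ : ℝ}
    (hℓ : 2 ≤ ℓ) (k : ℕ) :
    ∑ j ∈ Finset.range k, g ((2 ^ j * ℓ) ^ d) ≤ 2 * ∫ y in (1 : ℝ)..(2 ^ k * ℓ) ^ d, g y / y := by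
  have hInt := fun u v (hu : (1 : ℝ) ≤ u) (hv : 1 ≤ v) => intervalIntegrable_div_id hmono hu hv
  have hone : ∀ r : ℝ, 1 ≤ r → ∀ j : ℕ, (1 : ℝ) ≤ (2 ^ j * r) ^ d := fun r hr j =>
    one_le_pow₀ (one_le_mul_of_one_le_of_one_le (one_le_pow₀ one_le_two) hr)
  have hstep : ∀ r : ℝ, 1 ≤ r → ∀ j : ℕ, 2 * (2 ^ j * r) ^ d ≤ (2 ^ (j + 1) * r) ^ d :=
    fun r hr j => by
      rw [pow_succ', mul_assoc, mul_pow 2]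
      gcongr
      exact le_self_pow₀ one_le_two hd.ne'
  have hG : ∀ j : ℕ, 0 ≤ g ((2 ^ j * ℓ) ^ d) := fun j => (hg _ (hone ℓ (by linarith) j)).le
  rcases hmono with h | h
  · exact sum_le_two_mul_integral hg hInt (x := fun j => (2 ^ j * ℓ) ^ d)
      (hone ℓ (by linarith) 0) (hstep ℓ (by linarith)) hG
      (fun j y hy => h (hone ℓ (by linarith) j) ((hone ℓ (by linarith) j).trans hy.1) hy.1) k
  · have hr : 1 ≤ ℓ / 2 := by linarith
    have hx : ∀ j : ℕ, ((2 : ℝ) ^ (j + 1) * (ℓ / 2)) ^ d = (2 ^ j * ℓ) ^ d := fun j => by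
      rw [pow_succ]; ring_nf
    refine (sum_le_two_mul_integral hg hInt (x := fun j => (2 ^ j * (ℓ / 2)) ^ d)
      (hone _ hr 0) (hstep _ hr) hG (fun j y hy => ?_) k).trans ?_
    · simp only [hx] at hy
      exact h ((hone _ hr j).trans hy.1) (hone ℓ (by linarith) j) hy.2
    · have hle : ((2 : ℝ) ^ k * (ℓ / 2)) ^ d ≤ (2 ^ k * ℓ) ^ d := by gcongr; linarith
      rw [← intervalIntegral.integral_add_adjacent_intervals (hInt 1 _ le_rfl (hone _ hr k))
        (hInt _ _ (hone _ hr k) (hone ℓ (by linarith) k))]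
      have : 0 ≤ ∫ y in (2 ^ k * (ℓ / 2)) ^ d..(2 ^ k * ℓ) ^ d, g y / y :=
        intervalIntegral.integral_nonneg hle fun y hy => by
          have h1 := (hone _ hr k).trans hy.1
          exact div_nonneg (hg y h1).le (zero_le_one.trans h1)
      linarith

theorem exists_eq_two_pow_mul {L : ℝ} (hL : 0 < L) :
    ∃ (k : ℕ) (ℓ : ℝ), L = 2 ^ k * ℓ ∧ 0 < ℓ ∧ ℓ ≤ 4 ∧ (k = 0 ∨ 2 ≤ ℓ) := by
  rcases lt_or_ge L 2 with h | h
  · exact ⟨0, L, by simp, hL, by linarith, Or.inl rfl⟩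
  · obtain ⟨k, h1, h2⟩ := exists_nat_pow_near (x := L / 2) (by linarith) one_lt_two
    have h2k : (0 : ℝ) < 2 ^ k := by positivity
    rw [pow_succ] at h2
    refine ⟨k, L / 2 ^ k, by field_simp, by positivity, ?_, Or.inr ?_⟩
    · rw [div_le_iff₀ h2k]; linarith
    · rw [le_div_iff₀ h2k]; linarith

end Sums

theorem WpPow_le {d : ℕ} {p : ℝ} {μ ν : Measure (EuclideanSpace ℝ (Fin d))} {T : ℝ≥0∞}
    (h : TransportLE p μ ν T) : WpPow p μ ν ≤ T := by
  obtain ⟨π, h1, h2, h3⟩ := h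
  exact (iInf₂_le π ⟨h1, h2⟩).trans h3

/-- Theorem (main theorem, dimension `d`): for a random finite measure `μ_N` on
`Q_N = [0, N^{1/d}]^d` satisfying a `p`-th moment bound
`E[|μ_N(B) - E[μ_N(B)]|^p] ≤ |B|^{p(d-1)/d} g(|B|)^p` on cubes of volume at least `1`,
for a monotone `g`, and whose mean measure has density between `a` and `A`, one has
`E[W_p^p(μ_N, μ̄_N)] ≤ C_{p,d} a^{1-2p} A^p N (1 + ∫_1^{max(1,N)} g(y)/y dy)^p`,
where `μ̄_N = (M_N / E[M_N]) E[μ_N]` and `M_N = μ_N(Q_N)`. -/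
theorem main_theorem_dim_d (d : ℕ) (hd : 0 < d) (p : ℝ) (hp : 1 ≤ p) :
    ∃ C : ℝ, 0 < C ∧
      ∀ (N : ℝ), 0 < N →
      ∀ (Ω : Type) (_ : MeasurableSpace Ω) (P : Measure Ω), IsProbabilityMeasure P →
      ∀ (μ : Ω → Measure (EuclideanSpace ℝ (Fin d))),
      (∀ ω, IsFiniteMeasure (μ ω)) →
      (∀ ω, μ ω (QdN d N)ᶜ = 0) →
      (∀ B : Set (EuclideanSpace ℝ (Fin d)), MeasurableSet B →
        Measurable fun ω => μ ω B) →
      ∀ (Eμ : Measure (EuclideanSpace ℝ (Fin d))),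
      (∀ B : Set (EuclideanSpace ℝ (Fin d)), MeasurableSet B →
        Eμ B = ∫⁻ ω, μ ω B ∂P) →
      ∀ (g : ℝ → ℝ),
      (∀ y, 1 ≤ y → 0 < g y) →
      (MonotoneOn g (Set.Ici 1) ∨ AntitoneOn g (Set.Ici 1)) →
      -- Hypothesis 1: moment bound on cubes of volume at least 1
      (∀ B : Set (EuclideanSpace ℝ (Fin d)), IsAxisCube B → B ⊆ QdN d N →
        1 ≤ (volume B).toReal →
        ∫⁻ ω, ENNReal.ofReal (|(μ ω B).toReal - (Eμ B).toReal| ^ p) ∂P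
          ≤ ENNReal.ofReal ((volume B).toReal ^ (p * (d - 1) / d)
              * g ((volume B).toReal) ^ p)) →
      ∀ (a A : ℝ), a ∈ Set.Ioc (0 : ℝ) 1 → A ∈ Set.Ici (1 : ℝ) →
      -- Hypothesis 2: density of the mean measure between a and A
      (∀ B : Set (EuclideanSpace ℝ (Fin d)), IsAxisCube B → B ⊆ QdN d N →
        ENNReal.ofReal (a * (volume B).toReal) ≤ Eμ B ∧
          Eμ B ≤ ENNReal.ofReal (A * (volume B).toReal)) →
      -- Conclusion
      ∫⁻ ω, WpPow p (μ ω) ((μ ω (QdN d N) / Eμ (QdN d N)) • Eμ) ∂P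
        ≤ ENNReal.ofReal (C * a ^ (1 - 2 * p) * A ^ p * N *
            (1 + ∫ y in (1:ℝ)..(max 1 N), g y / y) ^ p) := by
  have hp0 : 0 < p := zero_lt_one.trans_le hp
  have hd' : (0 : ℝ) < d := by exact_mod_cast hd
  set C₀ : ℝ := stepConst d p * (2 ^ (d + 1)) ^ p * (2 ^ d) ^ p + (√d * 4) ^ p with hC₀
  have hst := stepConst_nonneg d p
  have hC₀pos : 0 < C₀ := by positivity
  refine ⟨C₀ * 2 ^ p, by positivity, ?_⟩
  intro N hN Ω _ P _ μ hfin hsupp hmeas Eμ hEμ g hg hmono hmom a A ha hA hdens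
  obtain ⟨ha0, ha1⟩ := ha
  have hA1 : 1 ≤ A := hA
  have haA : a ≤ A := ha1.trans hA1
  set L : ℝ := N ^ ((1 : ℝ) / d) with hL
  have hLpos : 0 < L := by positivity
  have hLd : L ^ d = N := by
    rw [hL, ← Real.rpow_mul_natCast hN.le, one_div_mul_cancel hd'.ne', Real.rpow_one]
  have hQ : QdN d N = closedCube 0 L := by
    ext x
    simp [QdN, closedCube, hL]
  have hinside : CubeInside L (0 : EuclideanSpace ℝ (Fin d)) L := ⟨hLpos, fun i => by simp⟩
  have hsub : ∀ (c : EuclideanSpace ℝ (Fin d)) s, CubeInside L c s →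
      closedCube c s ⊆ QdN d N := fun c s h x hx i =>
    ⟨(h.2 i).1.trans (hx i).1, (hx i).2.trans (h.2 i).2⟩
  have haxis : ∀ (c : EuclideanSpace ℝ (Fin d)) s, CubeInside L c s → IsAxisCube (closedCube c s) :=
    fun c s h => ⟨c, s, h.1.le, rfl⟩
  have hdens' : ∀ (c : EuclideanSpace ℝ (Fin d)) s, CubeInside L c s →
      ENNReal.ofReal (a * s ^ d) ≤ Eμ (closedCube c s) ∧
        Eμ (closedCube c s) ≤ ENNReal.ofReal (A * s ^ d) := fun c s h => by
    rw [← volume_closedCube (c := c) h.1.le]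
    exact hdens _ (haxis c s h) (hsub c s h)
  have hnull : ∀ (c : EuclideanSpace ℝ (Fin d)) s, CubeInside L c s →
      Eμ (closedCube c s \ halfCube c s) = 0 := fun c s h =>
    measure_closedCube_diff_halfCube (fun c s h => (hdens' c s h).2) h
  have hnullω : ∀ (c : EuclideanSpace ℝ (Fin d)) s, CubeInside L c s →
      ∀ᵐ ω ∂P, μ ω (closedCube c s \ halfCube c s) = 0 := fun c s h => by
    have hm := (measurableSet_closedCube (c := c) (s := s)).diff
      (measurableSet_halfCube (c := c) (s := s))
    have h1 := hnull c s h
    rw [hEμ _ hm, lintegral_eq_zero_iff (hmeas _ hm)] at h1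
    exact h1
  have heq : ∀ (c : EuclideanSpace ℝ (Fin d)) s (m : Measure (EuclideanSpace ℝ (Fin d))),
      m (closedCube c s \ halfCube c s) = 0 → m (closedCube c s) = m (halfCube c s) :=
    fun c s m h => by
      rw [← measure_sdiff_add_inter _ measurableSet_halfCube, h, zero_add,
        Set.inter_eq_self_of_subset_right halfCube_subset_closedCube]
  have hν : ∀ (c : EuclideanSpace ℝ (Fin d)) s, CubeInside L c s →
      ENNReal.ofReal (a * s ^ d) ≤ Eμ (halfCube c s) ∧
        Eμ (halfCube c s) ≤ ENNReal.ofReal (A * s ^ d) := fun c s h => by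
    rw [← heq c s Eμ (hnull c s h)]
    exact hdens' c s h
  have hmom' : ∀ (c : EuclideanSpace ℝ (Fin d)) s, CubeInside L c s → 1 ≤ s →
      ∫⁻ ω, ENNReal.ofReal (|(μ ω (halfCube c s)).toReal - (Eμ (halfCube c s)).toReal| ^ p) ∂P ≤
        ENNReal.ofReal ((s ^ d) ^ (p * (d - 1) / d) * g (s ^ d) ^ p) := fun c s h h1 => by
    have h2 := hmom _ (haxis c s h) (hsub c s h)
    rw [volume_closedCube h.1.le] at h2
    refine le_of_eq_of_le (lintegral_congr_ae ?_) (h2 (one_le_pow₀ h1))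
    filter_upwards [hnullω c s h] with ω hω
    rw [heq c s Eμ (hnull c s h), heq c s (μ ω) hω]
  have hQm : MeasurableSet (QdN d N) := hQ ▸ measurableSet_closedCube
  have hEsupp : Eμ (QdN d N)ᶜ = 0 := by
    rw [hEμ _ hQm.compl]
    simp [hsupp]
  have hrestrict : ∀ m : Measure (EuclideanSpace ℝ (Fin d)), m (QdN d N)ᶜ = 0 →
      m (closedCube 0 L \ halfCube 0 L) = 0 → m.restrict (halfCube 0 L) = m := fun m h1 h2 => by
    refine Measure.restrict_eq_self_of_ae_mem ?_
    refine measure_mono_null (fun x hx => ?_) (measure_union_null h1 h2)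
    by_cases h : x ∈ QdN d N
    · exact Or.inr ⟨hQ ▸ h, hx⟩
    · exact Or.inl h
  have hEfin : IsFiniteMeasure Eμ := by
    refine ⟨?_⟩
    rw [← measure_add_measure_compl hQm, hEsupp, add_zero, hQ]
    exact (hdens' _ _ hinside).2.trans_lt ENNReal.ofReal_lt_top
  obtain ⟨k, ℓ, hk, hℓ0, hℓ4, hkℓ⟩ := exists_eq_two_pow_mul hLpos
  have hAp : A ≤ A ^ p := Real.self_le_rpow_of_one_le hA1 hp
  have hap : 1 ≤ a ^ (1 - 2 * p) :=
    Real.one_le_rpow_of_pos_of_le_one_of_nonpos ha0 ha1 (by linarith)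
  have hA0 : 0 < A := zero_lt_one.trans_le hA1
  set D : ℝ := A ^ p * a ^ (1 - 2 * p) with hD
  have hD0 : 0 < D := by positivity
  have hAD : A ≤ D := hAp.trans (le_mul_of_one_le_right (by positivity) hap)
  have hΛ : ((C₀ * D) ^ (1 / p)) ^ p = C₀ * D := by
    rw [← Real.rpow_mul (by positivity), one_div_mul_cancel hp0.ne', Real.rpow_one]
  obtain ⟨Y, -, hYt, hYi⟩ := exists_transportLE_dyadic (P := P) (Λ := (C₀ * D) ^ (1 / p)) hd hp ha0
    haA (by positivity)
    (by
      rw [hΛ, hC₀]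
      calc _ = (stepConst d p * (2 ^ (d + 1)) ^ p * (2 ^ d) ^ p) * D := by ring
        _ ≤ _ := by
          gcongr
          exact le_add_of_nonneg_right (by positivity))
    (by
      rw [hΛ, hC₀]
      gcongr
      exact le_add_of_nonneg_of_le (by positivity) (by gcongr)) hℓ0 hmeas hEμ hν hg hmom' k
    (hkℓ.imp_right fun h => by linarith) 0 (by rwa [← hk])
  rw [← hk, hLd] at hYi
  rw [← hk] at hYt
  have hI0 : 0 ≤ ∫ y in (1 : ℝ)..max 1 N, g y / y :=
    intervalIntegral.integral_nonneg (le_max_left _ _) fun y hy =>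
      div_nonneg (hg y hy.1).le (zero_le_one.trans hy.1)
  have hsum0 : 0 ≤ ∑ j ∈ Finset.range k, g ((2 ^ j * ℓ) ^ d) := by
    rcases hkℓ with h | h
    · simp [h]
    · exact Finset.sum_nonneg fun j _ => (hg _ (one_le_pow₀ (one_le_mul_of_one_le_of_one_le
        (one_le_pow₀ one_le_two) (by linarith)))).le
  have hsum : ∑ j ∈ Finset.range k, g ((2 ^ j * ℓ) ^ d) ≤ 2 * ∫ y in (1 : ℝ)..max 1 N, g y / y := by
    rcases hkℓ with h | h
    · simpa [h] using hI0
    · have h1 := sum_dyadic_le_two_mul_integral hg hmono hd h k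
      have h2 : 1 ≤ N := by
        rw [← hLd, hk]
        exact one_le_pow₀ (one_le_mul_of_one_le_of_one_le (one_le_pow₀ one_le_two) (by linarith))
      rwa [← hk, hLd, ← max_eq_right h2] at h1
  calc ∫⁻ ω, WpPow p (μ ω) ((μ ω (QdN d N) / Eμ (QdN d N)) • Eμ) ∂P ≤ ∫⁻ ω, Y ω ^ p ∂P := by
        refine lintegral_mono_ae ?_
        filter_upwards [hnullω _ _ hinside] with ω hω
        refine WpPow_le ?_
        have h1 := hYt ω
        rw [hrestrict _ (hsupp ω) hω, hrestrict _ hEsupp (hnull _ _ hinside), ← heq _ _ _ hω,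
          ← heq _ _ _ (hnull _ _ hinside), ← hQ, ← ENNReal.toReal_div, ENNReal.ofReal_toReal] at h1
        · exact h1
        · refine ENNReal.div_ne_top (measure_ne_top _ _) ?_
          rw [hQ]
          exact (lt_of_lt_of_le (ENNReal.ofReal_pos.2 (by positivity)) (hdens' _ _ hinside).1).ne'
    _ ≤ _ := hYi
    _ = ENNReal.ofReal (N * ((C₀ * D) *
          (1 + ∑ j ∈ Finset.range k, g ((2 ^ j * ℓ) ^ d)) ^ p)) := by
        rw [ENNReal.ofReal_rpow_of_nonneg (by positivity) hp0.le, Real.mul_rpow (by positivity)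
          (by positivity), hΛ, ENNReal.ofReal_mul hN.le]
    _ ≤ _ := by
        apply ENNReal.ofReal_le_ofReal
        calc _ ≤ N * ((C₀ * D) * (2 * (1 + ∫ y in (1 : ℝ)..max 1 N, g y / y)) ^ p) := by
              gcongr
              linarith
          _ = _ := by
              rw [Real.mul_rpow zero_le_two (by positivity), hD]
              ring
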